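/- arXiv:2201.04457 — 3 statements merged into one kernel-verified Lean document; each statement's English description precedes it below -/
import Mathlib

section
/- Let G = (V ∪ ℒ, D) be a latent-factor graph, let v ∈ V, and suppose the triple (Y, Z, H) with Y, Z ⊆ V∖{v} and H ⊆ ℒ satisfies the latent-factor half-trek criterion (LF-HTC) with respect to v. If every directed edge u → y ∈ D_V whose head y lies in Z ∪ (Y ∩ htr_H(Z ∪ {v})) is rationally identifiable, then every directed edge in D_V with head v is rationally identifiable. -/
open scoped Classical
open Matrix

namespace LFG

variable {V L : Type*} [DecidableEq V] [DecidableEq L]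

/-- Observed parents of a node `v`: nodes `w` with `w → v` in `D_V`. -/
def paV (DV : Finset (V × V)) (v : V) : Finset V :=
  (DV.filter fun e => e.2 = v).image Prod.fst

/-- Latent parents of a set `W` of observed nodes. -/
def paL (DLV : Finset (L × V)) (W : Finset V) : Finset L :=
  (DLV.filter fun e => e.2 ∈ W).image Prod.fst

/-- Observed children of a set `H` of latent nodes. -/
def chL (DLV : Finset (L × V)) (H : Finset L) : Finset V :=
  (DLV.filter fun e => e.1 ∈ H).image Prod.snd

/-- A latent-factor half-trek: either a directed path
`source → x₁ → ⋯ → xₙ → target` (when `latent = none`, with node list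
`source :: tail`), or `source ← h → x₁ → ⋯ → xₙ → target`
(when `latent = some h`, with observed node list `tail ≠ []`).
Trivial half-treks (`latent = none`, `tail = []`) are allowed. -/
structure HalfTrek (DV : Finset (V × V)) (DLV : Finset (L × V)) where
  source : V
  latent : Option L
  tail : List V
  chain : List.Chain' (fun a b => (a, b) ∈ DV) tail
  src_edge : latent = none → ∀ x ∈ tail.head?, (source, x) ∈ DV
  latent_src : ∀ h, latent = some h → (h, source) ∈ DLV
  latent_head : ∀ h, latent = some h → ∃ x, tail.head? = some x ∧ (h, x) ∈ DLV

variable {DV : Finset (V × V)} {DLV : Finset (L × V)}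

/-- The target of a half-trek. -/
def HalfTrek.target (t : HalfTrek DV DLV) : V := t.tail.getLastD t.source

/-- Observed part of the left-hand side of a half-trek. -/
def HalfTrek.leftV (t : HalfTrek DV DLV) : Finset V := {t.source}

/-- Latent node of a half-trek (both on its left- and right-hand side). -/
def HalfTrek.lats (t : HalfTrek DV DLV) : Finset L := t.latent.toFinset

/-- Observed part of the right-hand side of a half-trek. -/
def HalfTrek.rightV (t : HalfTrek DV DLV) : Finset V :=
  match t.latent with
  | none => insert t.source t.tail.toFinset
  | some _ => t.tail.toFinset

/-- The half-trek avoids all latent nodes in `H`. -/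
def HalfTrek.Avoids (t : HalfTrek DV DLV) (H : Finset L) : Prop :=
  ∀ h, t.latent = some h → h ∉ H

/-- `w` is half-trek reachable from `u` while avoiding `H` (for distinct `u ≠ w`). -/
def HtrFrom (DV : Finset (V × V)) (DLV : Finset (L × V)) (H : Finset L) (u w : V) : Prop :=
  u ≠ w ∧ ∃ t : HalfTrek DV DLV, t.source = u ∧ t.target = w ∧ t.Avoids H

/-- `w ∈ htr_H(U)`. -/
def HtrReach (DV : Finset (V × V)) (DLV : Finset (L × V)) (H : Finset L)
    (U : Finset V) (w : V) : Prop :=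
  ∃ u ∈ U, HtrFrom DV DLV H u w

/-- Two half-treks have no sided intersection. -/
def NSI (t₁ t₂ : HalfTrek DV DLV) : Prop :=
  Disjoint t₁.leftV t₂.leftV ∧ Disjoint t₁.lats t₂.lats ∧ Disjoint t₁.rightV t₂.rightV

/-- A system of latent-factor half-treks with no sided intersection from `Y` to `T`,
indexed by targets. -/
def IsHTSystem (DV : Finset (V × V)) (DLV : Finset (L × V)) (Y T : Finset V)
    (f : V → HalfTrek DV DLV) : Prop :=
  (∀ b ∈ T, (f b).target = b) ∧
  T.image (fun b => (f b).source) = Y ∧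
  ∀ b₁ ∈ T, ∀ b₂ ∈ T, b₁ ≠ b₂ → NSI (f b₁) (f b₂)

/-- The triple `(Y, Z, H)` satisfies the latent-factor half-trek criterion (LF-HTC)
with respect to `v`. -/
def SatisfiesLFHTC (DV : Finset (V × V)) (DLV : Finset (L × V)) (v : V)
    (Y Z : Finset V) (H : Finset L) : Prop :=
  v ∉ Y ∧ v ∉ Z ∧
  Y.card = (paV DV v).card + H.card ∧
  Z.card = H.card ∧
  Disjoint Z (paV DV v) ∧
  Disjoint Y (insert v Z) ∧
  (paL DLV Y ∩ paL DLV (insert v Z) ⊆ H) ∧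
  ∃ f : V → HalfTrek DV DLV,
    IsHTSystem DV DLV Y (Z ∪ paV DV v) f ∧
    ∀ z ∈ Z, ∃ h ∈ H, (f z).latent = some h ∧ (f z).tail = [z]

section Matrices

variable [Fintype V] [Fintype L]

/-- The observed covariance matrix `Σ = (I-Λ)^{-⊤} (Ω_diag + Γ^⊤Γ) (I-Λ)^{-1}`. -/
noncomputable def SigmaMat (Λ : Matrix V V ℝ) (Γ : Matrix L V ℝ) (ω : V → ℝ) :
    Matrix V V ℝ :=
  ((1 - Λ)ᵀ)⁻¹ * (Matrix.diagonal ω + Γᵀ * Γ) * (1 - Λ)⁻¹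

/-- The parameters `(Λ, Γ, Ω_diag)` belong to `ℝ^{D_V}_reg × ℝ^{D_{ℒV}} × diag⁺_d`. -/
def GoodParams (DV : Finset (V × V)) (DLV : Finset (L × V))
    (Λ : Matrix V V ℝ) (Γ : Matrix L V ℝ) (ω : V → ℝ) : Prop :=
  (∀ a b : V, (a, b) ∉ DV → Λ a b = 0) ∧
  IsUnit (1 - Λ) ∧
  (∀ h a, (h, a) ∉ DLV → Γ h a = 0) ∧
  (∀ a, 0 < ω a)

/-- Index type for the free parameter coordinates of `(Λ, Γ, Ω_diag)`. -/
abbrev ParamVar (DV : Finset (V × V)) (DLV : Finset (L × V)) : Type _ :=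
  {e : V × V // e ∈ DV} ⊕ {e : L × V // e ∈ DLV} ⊕ V

/-- Evaluation of the parameter coordinates. -/
def evalParam (DV : Finset (V × V)) (DLV : Finset (L × V))
    (Λ : Matrix V V ℝ) (Γ : Matrix L V ℝ) (ω : V → ℝ) : ParamVar DV DLV → ℝ
  | Sum.inl e => Λ e.1.1 e.1.2
  | Sum.inr (Sum.inl e) => Γ e.1.1 e.1.2
  | Sum.inr (Sum.inr a) => ω a

/-- Evaluation of the entries of `Σ`. -/
noncomputable def sigmaEval (Λ : Matrix V V ℝ) (Γ : Matrix L V ℝ) (ω : V → ℝ) :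
    V × V → ℝ := fun e => SigmaMat Λ Γ ω e.1 e.2

/-- The direct effect `λ_{wv}` (the edge `w → v`) is rationally identifiable. -/
def RatIdent (DV : Finset (V × V)) (DLV : Finset (L × V)) (w v : V) : Prop :=
  ∃ (p q : MvPolynomial (V × V) ℝ) (g : MvPolynomial (ParamVar DV DLV) ℝ),
    g ≠ 0 ∧
    ∀ (Λ : Matrix V V ℝ) (Γ : Matrix L V ℝ) (ω : V → ℝ),
      GoodParams DV DLV Λ Γ ω →
      MvPolynomial.eval (evalParam DV DLV Λ Γ ω) g ≠ 0 →
      MvPolynomial.eval (sigmaEval Λ Γ ω) q ≠ 0 ∧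
      Λ w v * MvPolynomial.eval (sigmaEval Λ Γ ω) q
        = MvPolynomial.eval (sigmaEval Λ Γ ω) p

/-- The entry `Ω_{ij}` of the latent covariance matrix is rationally identifiable. -/
def OmegaIdent (DV : Finset (V × V)) (DLV : Finset (L × V)) (i j : V) : Prop :=
  ∃ (p q : MvPolynomial (V × V) ℝ) (g : MvPolynomial (ParamVar DV DLV) ℝ),
    g ≠ 0 ∧
    ∀ (Λ : Matrix V V ℝ) (Γ : Matrix L V ℝ) (ω : V → ℝ),
      GoodParams DV DLV Λ Γ ω →
      MvPolynomial.eval (evalParam DV DLV Λ Γ ω) g ≠ 0 →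
      MvPolynomial.eval (sigmaEval Λ Γ ω) q ≠ 0 ∧
      (Matrix.diagonal ω + Γᵀ * Γ) i j * MvPolynomial.eval (sigmaEval Λ Γ ω) q
        = MvPolynomial.eval (sigmaEval Λ Γ ω) p

end Matrices

end LFG

namespace LFG

section Generic

variable {V L : Type*} [Fintype V] [DecidableEq V]

/-- Triples `(Λ, Γ, ω)` of real parameter matrices. -/
abbrev Params (V L : Type*) : Type _ := Matrix V V ℝ × Matrix L V ℝ × (V → ℝ)

/-- The filter of sets of parameters that contain every admissible parameter triple outside
the zero set of some nonzero polynomial. -/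
def generic (DV : Finset (V × V)) (DLV : Finset (L × V)) : Filter (Params V L) where
  sets := {S | ∃ g : MvPolynomial (ParamVar DV DLV) ℝ, g ≠ 0 ∧ ∀ θ : Params V L,
    GoodParams DV DLV θ.1 θ.2.1 θ.2.2 →
    MvPolynomial.eval (evalParam DV DLV θ.1 θ.2.1 θ.2.2) g ≠ 0 → θ ∈ S}
  univ_sets := ⟨1, one_ne_zero, fun _ _ _ => trivial⟩
  sets_of_superset := by
    rintro S T ⟨g, hg, h⟩ hST
    exact ⟨g, hg, fun θ h1 h2 => hST (h θ h1 h2)⟩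
  inter_sets := by
    rintro S T ⟨g, hg, h⟩ ⟨g', hg', h'⟩
    refine ⟨g * g', mul_ne_zero hg hg', fun θ h1 h2 => ?_⟩
    rw [map_mul] at h2
    exact ⟨h θ h1 (left_ne_zero_of_mul h2), h' θ h1 (right_ne_zero_of_mul h2)⟩

variable {DV : Finset (V × V)} {DLV : Finset (L × V)}

theorem eventually_good :
    ∀ᶠ θ in generic DV DLV, GoodParams DV DLV θ.1 θ.2.1 θ.2.2 :=
  ⟨1, one_ne_zero, fun _ h _ => h⟩

theorem eventually_eval_ne_zero {g : MvPolynomial (ParamVar DV DLV) ℝ} (hg : g ≠ 0) :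
    ∀ᶠ θ in generic DV DLV,
      MvPolynomial.eval (evalParam DV DLV θ.1 θ.2.1 θ.2.2) g ≠ 0 :=
  ⟨g, hg, fun _ _ h => h⟩

variable [Fintype L]

/-- A real function of the parameters that generically is a rational function of `Σ`. -/
def GenRat (DV : Finset (V × V)) (DLV : Finset (L × V)) (F : Params V L → ℝ) : Prop :=
  ∃ p q : MvPolynomial (V × V) ℝ, ∀ᶠ θ in generic DV DLV,
    MvPolynomial.eval (sigmaEval θ.1 θ.2.1 θ.2.2) q ≠ 0 ∧
    F θ * MvPolynomial.eval (sigmaEval θ.1 θ.2.1 θ.2.2) q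
      = MvPolynomial.eval (sigmaEval θ.1 θ.2.1 θ.2.2) p

theorem ratIdent_iff_genRat {w v : V} :
    RatIdent DV DLV w v ↔ GenRat DV DLV (fun θ => θ.1 w v) := by
  constructor
  · rintro ⟨p, q, g, hg, h⟩
    exact ⟨p, q, g, hg, fun θ => h θ.1 θ.2.1 θ.2.2⟩
  · rintro ⟨p, q, g, hg, h⟩
    exact ⟨p, q, g, hg, fun Λ Γ ω => h (Λ, Γ, ω)⟩

namespace GenRat

variable {F G : Params V L → ℝ}

theorem congr' (hF : GenRat DV DLV F) (h : ∀ᶠ θ in generic DV DLV, F θ = G θ) :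
    GenRat DV DLV G := by
  obtain ⟨p, q, hpq⟩ := hF
  refine ⟨p, q, ?_⟩
  filter_upwards [hpq, h] with θ h1 h2
  rwa [← h2]

theorem const (c : ℝ) : GenRat DV DLV (fun _ => c) :=
  ⟨MvPolynomial.C c, 1, Filter.Eventually.of_forall fun θ => by simp⟩

theorem sigma (i j : V) : GenRat DV DLV (fun θ => SigmaMat θ.1 θ.2.1 θ.2.2 i j) :=
  ⟨MvPolynomial.X (i, j), 1, Filter.Eventually.of_forall fun θ => by simp [sigmaEval]⟩

theorem add (hF : GenRat DV DLV F) (hG : GenRat DV DLV G) :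
    GenRat DV DLV (fun θ => F θ + G θ) := by
  obtain ⟨p, q, hpq⟩ := hF
  obtain ⟨p', q', hpq'⟩ := hG
  refine ⟨p * q' + p' * q, q * q', ?_⟩
  filter_upwards [hpq, hpq'] with θ h h'
  simp only [map_add, map_mul]
  refine ⟨mul_ne_zero h.1 h'.1, ?_⟩
  rw [← h.2, ← h'.2]
  ring

theorem mul (hF : GenRat DV DLV F) (hG : GenRat DV DLV G) :
    GenRat DV DLV (fun θ => F θ * G θ) := by
  obtain ⟨p, q, hpq⟩ := hF
  obtain ⟨p', q', hpq'⟩ := hG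
  refine ⟨p * p', q * q', ?_⟩
  filter_upwards [hpq, hpq'] with θ h h'
  simp only [map_mul]
  refine ⟨mul_ne_zero h.1 h'.1, ?_⟩
  rw [← h.2, ← h'.2]
  ring

theorem sub (hF : GenRat DV DLV F) (hG : GenRat DV DLV G) :
    GenRat DV DLV (fun θ => F θ - G θ) := by
  simpa [sub_eq_add_neg] using hF.add ((const (-1)).mul hG)

theorem div (hF : GenRat DV DLV F) (hG : GenRat DV DLV G)
    (hne : ∀ᶠ θ in generic DV DLV, G θ ≠ 0) : GenRat DV DLV (fun θ => F θ / G θ) := by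
  obtain ⟨p, q, hpq⟩ := hF
  obtain ⟨p', q', hpq'⟩ := hG
  refine ⟨p * q', q * p', ?_⟩
  filter_upwards [hpq, hpq', hne] with θ h h' hθ
  simp only [map_mul]
  rw [← h.2, ← h'.2]
  refine ⟨mul_ne_zero h.1 (mul_ne_zero hθ h'.1), ?_⟩
  field_simp

theorem sum {ι : Type*} (s : Finset ι) {F : ι → Params V L → ℝ}
    (h : ∀ i ∈ s, GenRat DV DLV (F i)) : GenRat DV DLV (fun θ => ∑ i ∈ s, F i θ) := by
  induction s using Finset.induction_on with
  | empty => simpa using const 0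
  | insert a s ha ih =>
    simp only [Finset.sum_insert ha]
    exact (h a (by simp)).add (ih fun i hi => h i (by simp [hi]))

theorem prod {ι : Type*} (s : Finset ι) {F : ι → Params V L → ℝ}
    (h : ∀ i ∈ s, GenRat DV DLV (F i)) : GenRat DV DLV (fun θ => ∏ i ∈ s, F i θ) := by
  induction s using Finset.induction_on with
  | empty => simpa using const 1
  | insert a s ha ih =>
    simp only [Finset.prod_insert ha]
    exact (h a (by simp)).mul (ih fun i hi => h i (by simp [hi]))

theorem det {n : Type*} [Fintype n] [DecidableEq n] {M : Params V L → Matrix n n ℝ}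
    (h : ∀ i j, GenRat DV DLV (fun θ => M θ i j)) : GenRat DV DLV (fun θ => (M θ).det) := by
  simp only [Matrix.det_apply']
  exact sum _ fun σ _ => (const _).mul (prod _ fun i _ => h _ _)

theorem matrix_mul {l m n : Type*} [Fintype m] {A : Params V L → Matrix l m ℝ}
    {B : Params V L → Matrix m n ℝ} (i : l) (j : n)
    (hA : ∀ k, GenRat DV DLV (fun θ => A θ i k)) (hB : ∀ k, GenRat DV DLV (fun θ => B θ k j)) :
    GenRat DV DLV (fun θ => (A θ * B θ) i j) := by
  simp only [Matrix.mul_apply]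
  exact sum _ fun k _ => (hA k).mul (hB k)

/-- The solution of a generically nonsingular linear system with generically rational
coefficients is generically rational. -/
theorem of_mulVec_eq {n : Type*} [Fintype n] [DecidableEq n] {M : Params V L → Matrix n n ℝ}
    {c : Params V L → n → ℝ} (hM : ∀ i j, GenRat DV DLV (fun θ => M θ i j))
    (hc : ∀ i, GenRat DV DLV (fun θ => c θ i))
    (hdet : ∀ᶠ θ in generic DV DLV, (M θ).det ≠ 0) (i : n)
    (h : ∀ᶠ θ in generic DV DLV, ∃ x : n → ℝ, x i = F θ ∧ M θ *ᵥ x = c θ) :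
    GenRat DV DLV F := by
  have hcr : GenRat DV DLV (fun θ => ((M θ).updateCol i (c θ)).det) := by
    refine det fun a b => ?_
    simp only [Matrix.updateCol_apply]
    split_ifs
    exacts [hc a, hM a b]
  refine (hcr.div (det hM) hdet).congr' ?_
  filter_upwards [hdet, h] with θ h1 ⟨x, hx, hMx⟩
  rw [div_eq_iff h1, ← Matrix.cramer_apply, Matrix.cramer_eq_adjugate_mulVec, ← hMx,
    Matrix.mulVec_mulVec, Matrix.adjugate_mul, Matrix.smul_mulVec, Matrix.one_mulVec, ← hx,
    Pi.smul_apply, smul_eq_mul, mul_comm]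

end GenRat

end Generic

section Factorization

variable {V : Type*} [DecidableEq V] {R S : Type*} [CommRing R] [CommRing S]

theorem map_one_sub (φ : R →+* S) (Λ : Matrix V V R) : (1 - Λ).map φ = 1 - Λ.map φ := by
  ext i j
  simp [Matrix.one_apply, apply_ite φ]

variable [Fintype V]

/-- The matrix whose row `y` is the row of the identity if `P y` holds, and the row of
`adj(I - Λ)ᵀ` otherwise. -/
noncomputable def leftFactor (P : V → Prop) (Λ : Matrix V V R) : Matrix V V R :=
  of fun y i => if P y then (1 : Matrix V V R) y i else (1 - Λ).adjugate i y

/-- The matrix whose column `w` is the column of the identity if `w ∈ Z`, and the column of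
`adj(I - Λ)` otherwise. -/
noncomputable def rightFactor (Z : Finset V) (Λ : Matrix V V R) : Matrix V V R :=
  of fun j w => if w ∈ Z then (1 : Matrix V V R) j w else (1 - Λ).adjugate j w

theorem map_adjugate_one_sub (φ : R →+* S) (Λ : Matrix V V R) (i j : V) :
    φ ((1 - Λ).adjugate i j) = (1 - Λ.map φ).adjugate i j := by
  rw [← map_one_sub φ Λ, ← RingHom.mapMatrix_apply φ (1 - Λ), ← RingHom.map_adjugate]
  simp

theorem map_leftFactor (φ : R →+* S) (P : V → Prop) (Λ : Matrix V V R) :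
    (leftFactor P Λ).map φ = leftFactor P (Λ.map φ) := by
  ext i j
  simp only [leftFactor, Matrix.map_apply, of_apply]
  split_ifs
  · simp [Matrix.one_apply, apply_ite φ]
  · exact map_adjugate_one_sub φ Λ _ _

theorem map_rightFactor (φ : R →+* S) (Z : Finset V) (Λ : Matrix V V R) :
    (rightFactor Z Λ).map φ = rightFactor Z (Λ.map φ) := by
  ext i j
  simp only [rightFactor, Matrix.map_apply, of_apply]
  split_ifs
  · simp [Matrix.one_apply, apply_ite φ]
  · exact map_adjugate_one_sub φ Λ _ _

end Factorization

section Paths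

variable {V : Type*} [Fintype V] {R : Type*} [CommRing R]
  {T : Type*} {n : T → ℕ} {p : T → ℕ → V}

/-- The adjacency matrix of a family of directed paths `p b 0 → p b 1 → ⋯ → p b (n b)`. -/
noncomputable def pathMatrix (R : Type*) [CommRing R] (n : T → ℕ) (p : T → ℕ → V) :
    Matrix V V R :=
  of fun i j => if ∃ b, ∃ k < n b, i = p b k ∧ j = p b (k + 1) then 1 else 0

/-- The paths `p b 0 → ⋯ → p b (n b)` are vertex-disjoint and each of them is simple. -/
def DisjointPaths (n : T → ℕ) (p : T → ℕ → V) : Prop :=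
  ∀ b b' i j, i ≤ n b → j ≤ n b' → p b i = p b' j → b = b' ∧ i = j

theorem vecMul_pathMatrix_succ (hp : DisjointPaths n p) (r : V → R) (b : T) {k : ℕ}
    (hk : k < n b) : (r ᵥ* pathMatrix R n p) (p b (k + 1)) = r (p b k) := by
  simp only [vecMul, dotProduct, pathMatrix, of_apply]
  rw [Finset.sum_eq_single (p b k)]
  · rw [if_pos ⟨b, k, hk, rfl, rfl⟩, mul_one]
  · intro i _ hi
    rw [if_neg, mul_zero]
    rintro ⟨b', k', hk', rfl, h⟩
    obtain ⟨rfl, h⟩ := hp _ _ _ _ hk hk' h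
    obtain rfl : k = k' := by omega
    exact hi rfl
  · simp

theorem vecMul_pathMatrix_of_forall_ne (r : V → R) (j : V)
    (hj : ∀ b, ∀ k < n b, j ≠ p b (k + 1)) : (r ᵥ* pathMatrix R n p) j = 0 := by
  simp only [vecMul, dotProduct, pathMatrix, of_apply]
  refine Finset.sum_eq_zero fun i _ => ?_
  rw [if_neg, mul_zero]
  rintro ⟨b, k, hk, -, h⟩
  exact hj b k hk h

theorem vecMul_pathMatrix_zero (hp : DisjointPaths n p) (r : V → R) (b : T) :
    (r ᵥ* pathMatrix R n p) (p b 0) = 0 := by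
  refine vecMul_pathMatrix_of_forall_ne r _ fun b' k hk h => ?_
  have := (hp _ _ _ _ (Nat.zero_le _) hk h).2
  omega

variable [DecidableEq V]

theorem det_one_sub_pathMatrix_ne_zero [IsDomain R] (hp : DisjointPaths n p) :
    (1 - pathMatrix R n p).det ≠ 0 := by
  rw [Ne, ← Matrix.exists_vecMul_eq_zero_iff]
  rintro ⟨r, hr, h⟩
  rw [Matrix.vecMul_sub, Matrix.vecMul_one, sub_eq_zero] at h
  apply hr
  have key : ∀ b k, k ≤ n b → r (p b k) = 0 := by
    intro b k
    induction k with
    | zero => intro _; rw [h, vecMul_pathMatrix_zero hp]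
    | succ k ih => intro hk; rw [h, vecMul_pathMatrix_succ hp r b hk, ih (by omega)]
  funext j
  by_cases hj : ∃ b, ∃ k < n b, j = p b (k + 1)
  · obtain ⟨b, k, hk, rfl⟩ := hj
    exact key b _ hk
  · push Not at hj
    rw [h, vecMul_pathMatrix_of_forall_ne r j hj]
    rfl

theorem adjugate_one_sub_pathMatrix (hp : DisjointPaths n p) (b b' : T) :
    (1 - pathMatrix R n p).adjugate (p b 0) (p b' (n b'))
      = if b = b' then (1 - pathMatrix R n p).det else 0 := by
  set r : V → R := fun j => if ∃ k ≤ n b, j = p b k then 1 else 0 with hr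
  have hrow : r ᵥ* (1 - pathMatrix R n p) = Pi.single (p b 0) 1 := by
    rw [Matrix.vecMul_sub, Matrix.vecMul_one]
    funext j
    rw [Pi.sub_apply, Pi.single_apply]
    by_cases hj : ∃ c, ∃ k < n c, j = p c (k + 1)
    · obtain ⟨c, k, hk, rfl⟩ := hj
      rw [vecMul_pathMatrix_succ hp r c hk, if_neg, sub_eq_zero]
      · simp only [hr]
        congr 1
        refine propext ⟨?_, ?_⟩
        · rintro ⟨k', hk', h⟩
          obtain ⟨rfl, -⟩ := hp _ _ _ _ hk hk' h
          exact ⟨k, hk.le, rfl⟩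
        · rintro ⟨k', hk', h⟩
          obtain ⟨rfl, -⟩ := hp _ _ _ _ hk.le hk' h
          exact ⟨k + 1, hk, rfl⟩
      · intro h
        have := (hp _ _ _ _ hk (Nat.zero_le _) h).2
        omega
    · push Not at hj
      rw [vecMul_pathMatrix_of_forall_ne r j hj, sub_zero]
      simp only [hr]
      congr 1
      refine propext ⟨?_, ?_⟩
      · rintro ⟨k, hk, h⟩
        cases k with
        | zero => exact h
        | succ k => exact absurd h (hj b k hk)
      · rintro rfl
        exact ⟨0, Nat.zero_le _, rfl⟩
  have h := congrArg (fun x => (x ᵥ* (1 - pathMatrix R n p).adjugate) (p b' (n b'))) hrow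
  simp only [Matrix.vecMul_vecMul, Matrix.mul_adjugate, Matrix.vecMul_smul, Matrix.vecMul_one,
    Matrix.single_one_vecMul, Pi.smul_apply, smul_eq_mul, Matrix.row_apply] at h
  rw [← h]
  simp only [hr]
  by_cases hb : b = b'
  · subst hb
    rw [if_pos ⟨_, le_rfl, rfl⟩, if_pos rfl, mul_one]
  · rw [if_neg, if_neg hb, mul_zero]
    rintro ⟨k, hk, h⟩
    exact hb (hp _ _ _ _ le_rfl hk h).1.symm

variable [Fintype T] [DecidableEq T]

open Polynomial in
/-- For disjoint simple directed paths from `p b 0` to `tgt b` and distinct sources `src b`, the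
coefficient matrix with edge weights `X` and latent factors `(1 - X) e_{src b} + X e_{p b 0}` is
nonsingular over `ℝ[X]`. -/
theorem det_factorization_ne_zero (hp : DisjointPaths n p) (P : V → Prop) (Z : Finset V)
    {src tgt : T → V} (hsrc : Function.Injective src) (htgt : ∀ b, p b (n b) = tgt b)
    (hZ : ∀ b, tgt b ∈ Z → p b 0 = tgt b) {Λ : Matrix V V ℝ[X]} {Γ : Matrix T V ℝ[X]}
    (hΛ : Λ = (X : ℝ[X]) • pathMatrix ℝ[X] n p)
    (hΓ : Γ = of fun b a => (1 - X) * (1 : Matrix V V ℝ[X]) (src b) a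
      + X * (1 : Matrix V V ℝ[X]) (p b 0) a) :
    ((leftFactor P Λ * (Γᵀ * Γ) * rightFactor Z Λ).submatrix src tgt).det ≠ 0 := by
  have hfac : (leftFactor P Λ * (Γᵀ * Γ) * rightFactor Z Λ).submatrix src tgt
      = ((leftFactor P Λ).submatrix src id * Γᵀ) * (Γ * (rightFactor Z Λ).submatrix id tgt) := by
    rw [← Matrix.mul_assoc, Matrix.mul_assoc (leftFactor P Λ * Γᵀ)]
    rfl
  have hmapΛ (c : ℝ) : Λ.map (evalRingHom c) = c • pathMatrix ℝ n p := by
    ext i j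
    simp [hΛ, pathMatrix, apply_ite (Polynomial.eval c)]
  have hmapΓ (c : ℝ) : Γ.map (evalRingHom c) = of fun b a => (1 - c) *
      (1 : Matrix V V ℝ) (src b) a + c * (1 : Matrix V V ℝ) (p b 0) a := by
    ext i j
    simp [hΓ, Matrix.one_apply, apply_ite (Polynomial.eval c)]
  rw [hfac, Matrix.det_mul]
  refine mul_ne_zero (fun h => ?_) (fun h => ?_)
  · have h0 := congrArg (evalRingHom (0 : ℝ)) h
    rw [RingHom.map_det, map_zero, RingHom.mapMatrix_apply, Matrix.map_mul,
      ← Matrix.submatrix_map, map_leftFactor, Matrix.transpose_map, hmapΛ, hmapΓ] at h0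
    have : (leftFactor P ((0 : ℝ) • pathMatrix ℝ n p)) = 1 := by
      ext i j
      simp [leftFactor, Matrix.one_apply, eq_comm]
    rw [this] at h0
    refine one_ne_zero (h0.symm.trans ?_).symm
    rw [← Matrix.det_one (n := T)]
    congr 1
    ext b b'
    simp [Matrix.mul_apply, Matrix.one_apply, hsrc.eq_iff, eq_comm]
  · have h1 := congrArg (evalRingHom (1 : ℝ)) h
    rw [RingHom.map_det, map_zero, RingHom.mapMatrix_apply, Matrix.map_mul,
      ← Matrix.submatrix_map, map_rightFactor, hmapΛ, hmapΓ, one_smul] at h1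
    have : ((of fun b a => (1 - (1 : ℝ)) * (1 : Matrix V V ℝ) (src b) a
        + 1 * (1 : Matrix V V ℝ) (p b 0) a) *
        (rightFactor Z (pathMatrix ℝ n p)).submatrix id tgt) = Matrix.diagonal fun b =>
          if tgt b ∈ Z then 1 else (1 - pathMatrix ℝ n p).det := by
      ext b b'
      simp only [Matrix.mul_apply, Matrix.one_apply, of_apply, sub_self, zero_mul, zero_add,
        one_mul, ite_mul, Finset.sum_ite_eq, Finset.mem_univ, if_true, rightFactor,
        Matrix.submatrix_apply, id, Matrix.diagonal_apply]
      by_cases hb : tgt b' ∈ Z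
      · have : p b 0 = tgt b' ↔ b = b' := by
          rw [← hZ b' hb]
          exact ⟨fun h => (hp _ _ _ _ (Nat.zero_le _) (Nat.zero_le _) h).1, fun h => by rw [h]⟩
        rw [if_pos hb]
        by_cases hbb : b = b'
        · simp [hbb, hb, hZ b' hb]
        · simp [this, hbb]
      · rw [if_neg hb, ← htgt b', adjugate_one_sub_pathMatrix hp]
        by_cases hbb : b = b'
        · simp [hbb, hb]
        · simp [hbb]
    rw [this, Matrix.det_diagonal, Finset.prod_eq_zero_iff] at h1
    obtain ⟨b, -, hb⟩ := h1
    split_ifs at hb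
    · exact one_ne_zero hb
    · exact det_one_sub_pathMatrix_ne_zero hp hb

end Paths

theorem exists_simple_path {α : Type*} {r : α → α → Prop} {l : List α} (hl : l.IsChain r)
    (hne : l ≠ []) : ∃ (n : ℕ) (p : ℕ → α), p 0 = l.head hne ∧ p n = l.getLast hne ∧
      (∀ i < n, r (p i) (p (i + 1))) ∧ (∀ i ≤ n, p i ∈ l) ∧
      ∀ i j, i ≤ n → j ≤ n → p i = p j → i = j := by
  have hex : ∃ (n : ℕ) (p : ℕ → α), p 0 = l.head hne ∧ p n = l.getLast hne ∧
      (∀ i < n, r (p i) (p (i + 1))) ∧ ∀ i ≤ n, p i ∈ l := by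
    have hpos := List.length_pos_of_ne_nil hne
    have hget (i : ℕ) (hi : i < l.length) : l.getD i (l.head hne) = l[i] := by
      simp [List.getD_eq_getElem?_getD, hi]
    refine ⟨l.length - 1, fun i => l.getD i (l.head hne), ?_, ?_, fun i hi => ?_, fun i hi => ?_⟩
    · simp only [hget 0 hpos]
      rw [List.head_eq_getElem]
    · simp only
      rw [hget _ (by omega), List.getLast_eq_getElem]
    · simp only
      rw [hget _ (by omega), hget _ (by omega)]
      exact List.isChain_iff_getElem.mp hl i (by omega)
    · simp only
      rw [hget _ (by omega)]
      exact List.getElem_mem _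
  obtain ⟨p, h0, hn, hr, hmem⟩ := Nat.find_spec hex
  have hmin := fun m => Nat.find_min hex (m := m)
  set n := Nat.find hex
  have hlt : ∀ i j, i < j → j ≤ n → p i ≠ p j := by
    intro i j hij hj hpij
    refine hmin (n - (j - i)) (by omega)
      ⟨fun k => if k ≤ i then p k else p (k + (j - i)), ?_, ?_, fun k hk => ?_, fun k hk => ?_⟩
    · simpa using h0
    · simp only
      split_ifs with h
      · obtain rfl : j = n := by omega
        rw [← hn, ← hpij]
        congr 1
        omega
      · rw [← hn]
        congr 1
        omega
    · simp only
      split_ifs with h1 h2 h2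
      · exact hr _ (by omega)
      · obtain rfl : k = i := by omega
        rw [hpij, show k + 1 + (j - k) = j + 1 by omega]
        exact hr _ (by omega)
      · omega
      · rw [show k + 1 + (j - i) = k + (j - i) + 1 by omega]
        exact hr _ (by omega)
    · simp only
      split_ifs
      · exact hmem _ (by omega)
      · exact hmem _ (by omega)
  refine ⟨n, p, h0, hn, hr, hmem, fun i j hi hj h => ?_⟩
  by_contra hne
  rcases Nat.lt_or_gt_of_ne hne with h' | h'
  · exact hlt i j h' hj h
  · exact hlt j i h' hi h.symm

theorem HalfTrek.exists_path {V L : Type*} [DecidableEq V] {DV : Finset (V × V)}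
    {DLV : Finset (L × V)} (t : HalfTrek DV DLV) : ∃ (n : ℕ) (p : ℕ → V),
      p n = t.target ∧ (∀ i < n, (p i, p (i + 1)) ∈ DV) ∧ (∀ i ≤ n, p i ∈ t.rightV) ∧
      (∀ i j, i ≤ n → j ≤ n → p i = p j → i = j) ∧ (t.latent = none → p 0 = t.source) ∧
      ∀ h, t.latent = some h → (h, p 0) ∈ DLV := by
  rcases hlat : t.latent with _ | h
  · have hchain : (t.source :: t.tail).IsChain fun a b => (a, b) ∈ DV :=
      List.isChain_cons.mpr ⟨t.src_edge hlat, t.chain⟩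
    obtain ⟨n, p, h0, hn, hr, hmem, hinj⟩ := exists_simple_path hchain (List.cons_ne_nil _ _)
    refine ⟨n, p, ?_, hr, fun i hi => ?_, hinj, fun _ => by simpa using h0, by simp⟩
    · rw [hn, HalfTrek.target, List.getLast_eq_getLastD]
    · simpa [HalfTrek.rightV, hlat] using hmem i hi
  · obtain ⟨x, hx, hxe⟩ := t.latent_head h hlat
    have hne : t.tail ≠ [] := by
      rintro h0
      simp [h0] at hx
    obtain ⟨n, p, h0, hn, hr, hmem, hinj⟩ := exists_simple_path (r := fun a b => (a, b) ∈ DV)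
      t.chain hne
    refine ⟨n, p, ?_, hr, fun i hi => ?_, hinj, by simp, fun h' hh' => ?_⟩
    · rw [hn, HalfTrek.target, List.getLastD_eq_getLast?, List.getLast?_eq_getLast_of_ne_nil hne]
      rfl
    · simpa [HalfTrek.rightV, hlat] using hmem i hi
    · rw [List.head?_eq_some_head hne] at hx
      obtain rfl := Option.some.inj hh'
      rw [h0, Option.some.inj hx]
      exact hxe

section ParamMatrices

variable {V L R S : Type*} [CommRing R] [CommRing S] {DV : Finset (V × V)} {DLV : Finset (L × V)}

/-- The matrix of edge weights given by the parameter coordinates `x`. -/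
noncomputable def lamOf (x : ParamVar DV DLV → R) : Matrix V V R :=
  of fun a b => if h : (a, b) ∈ DV then x (Sum.inl ⟨(a, b), h⟩) else 0

/-- The matrix of latent factor loadings given by the parameter coordinates `x`. -/
noncomputable def gamOf (x : ParamVar DV DLV → R) : Matrix L V R :=
  of fun h a => if e : (h, a) ∈ DLV then x (Sum.inr (Sum.inl ⟨(h, a), e⟩)) else 0

/-- The noise variances given by the parameter coordinates `x`. -/
def omOf (x : ParamVar DV DLV → R) (a : V) : R := x (Sum.inr (Sum.inr a))

theorem map_gamOf (φ : R →+* S) (x : ParamVar DV DLV → R) :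
    (gamOf x).map φ = gamOf (φ ∘ x) := by
  ext a b
  simp only [gamOf, Matrix.map_apply, of_apply]
  split_ifs <;> simp

theorem map_lamOf (φ : R →+* S) (x : ParamVar DV DLV → R) :
    (lamOf x).map φ = lamOf (φ ∘ x) := by
  ext a b
  simp only [lamOf, Matrix.map_apply, of_apply]
  split_ifs <;> simp


end ParamMatrices

section Coefficients

variable {V L R S : Type*} [Fintype V] [DecidableEq V] [CommRing R] [CommRing S]
  {DV : Finset (V × V)} {DLV : Finset (L × V)}

theorem lamOf_evalParam {Λ : Matrix V V ℝ} {Γ : Matrix L V ℝ} {ω : V → ℝ}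
    (h : GoodParams DV DLV Λ Γ ω) : lamOf (evalParam DV DLV Λ Γ ω) = Λ := by
  ext a b
  simp only [lamOf, of_apply]
  split_ifs with hab
  · rfl
  · exact (h.1 a b hab).symm

theorem gamOf_evalParam {Λ : Matrix V V ℝ} {Γ : Matrix L V ℝ} {ω : V → ℝ}
    (h : GoodParams DV DLV Λ Γ ω) : gamOf (evalParam DV DLV Λ Γ ω) = Γ := by
  ext a b
  simp only [gamOf, of_apply]
  split_ifs with hab
  · rfl
  · exact (h.2.2.1 a b hab).symm

theorem eventually_det_gamOf_ne_zero {T : Type*} [Fintype T] [DecidableEq T] {l : T → L}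
    {z : T → V} (hl : Function.Injective l) (hz : Function.Injective z)
    (he : ∀ b, (l b, z b) ∈ DLV) :
    ∀ᶠ θ in generic DV DLV, (θ.2.1.submatrix l z).det ≠ 0 := by
  have hg : ((gamOf (MvPolynomial.X (R := ℝ) : ParamVar DV DLV → _)).submatrix l z).det ≠ 0 := by
    intro h0
    set x : ParamVar DV DLV → ℝ := fun e => match e with
      | Sum.inr (Sum.inl e) => if ∃ b, e.1 = (l b, z b) then 1 else 0
      | _ => 0 with hx
    have h1 := congrArg (MvPolynomial.eval x) h0
    rw [RingHom.map_det, map_zero, RingHom.mapMatrix_apply, ← Matrix.submatrix_map,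
      map_gamOf] at h1
    refine one_ne_zero (h1.symm.trans ?_).symm
    rw [← Matrix.det_one (n := T)]
    congr 1
    ext b b'
    simp only [Matrix.submatrix_apply, gamOf, of_apply, Matrix.one_apply, Function.comp_apply,
      MvPolynomial.eval_X, hx]
    by_cases hb : b = b'
    · subst hb
      rw [dif_pos (he b), if_pos ⟨b, rfl⟩, if_pos rfl]
    · rw [if_neg hb]
      split_ifs with h2 h3
      · obtain ⟨c, hc⟩ := h3
        rw [Prod.mk.injEq] at hc
        exact absurd ((hl hc.1).trans (hz hc.2).symm) hb
      · rfl
      · rfl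
  filter_upwards [eventually_eval_ne_zero hg, eventually_good] with θ h1 h2
  rwa [RingHom.map_det, RingHom.mapMatrix_apply, ← Matrix.submatrix_map, map_gamOf,
    show (MvPolynomial.eval (evalParam DV DLV θ.1 θ.2.1 θ.2.2)) ∘ MvPolynomial.X
      = evalParam DV DLV θ.1 θ.2.1 θ.2.2 from funext fun i => MvPolynomial.eval_X i,
    gamOf_evalParam h2] at h1

variable [Fintype L]

/-- The coefficient matrix of the identifying linear system, with denominators cleared. -/
noncomputable def coefMatrix (P : V → Prop) (Z : Finset V) (x : ParamVar DV DLV → R) :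
    Matrix V V R :=
  leftFactor P (lamOf x) * (diagonal (omOf x) + (gamOf x)ᵀ * gamOf x) * rightFactor Z (lamOf x)

theorem map_coefMatrix (φ : R →+* S) (P : V → Prop) (Z : Finset V) (x : ParamVar DV DLV → R) :
    (coefMatrix P Z x).map φ = coefMatrix P Z (φ ∘ x) := by
  rw [coefMatrix, Matrix.map_mul, Matrix.map_mul, map_leftFactor, map_rightFactor,
    Matrix.map_add φ (map_add φ), Matrix.map_mul, Matrix.transpose_map, map_gamOf, map_lamOf,
    Matrix.diagonal_map (map_zero φ)]
  rfl

open Polynomial in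
/-- A system of half-treks without sided intersection makes the corresponding minor of the
coefficient matrix generically nonzero. -/
theorem eventually_det_coefMatrix_ne_zero {T : Type*} [Fintype T] [DecidableEq T]
    (P : V → Prop) (Z : Finset V) (f : T → HalfTrek DV DLV)
    (hf : ∀ b b', b ≠ b' → NSI (f b) (f b'))
    (hZ : ∀ b, (f b).target ∈ Z → (f b).latent ≠ none ∧ (f b).tail = [(f b).target]) :
    ∀ᶠ θ in generic DV DLV,
      ((coefMatrix P Z (evalParam DV DLV θ.1 θ.2.1 θ.2.2)).submatrix
        (fun b => (f b).source) (fun b => (f b).target)).det ≠ 0 := by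
  choose n p hn hr hmem hinj hnone hlat using fun b => (f b).exists_path
  have hp : DisjointPaths n p := by
    intro b b' i j hi hj h
    obtain rfl : b = b' := by
      by_contra hb
      refine Finset.disjoint_left.mp (hf b b' hb).2.2 (hmem b i hi) ?_
      rw [h]
      exact hmem b' j hj
    exact ⟨rfl, hinj b i j hi hj h⟩
  have hsrc : Function.Injective fun b => (f b).source := by
    intro b b' h
    by_contra hb
    have := (hf b b' hb).1
    simp [HalfTrek.leftV] at this
    exact this h
  have hlatinj : ∀ b b' h, (f b).latent = some h → (f b').latent = some h → b = b' := by
    intro b b' h h1 h2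
    by_contra hb
    have := (hf b b' hb).2.1
    simp [HalfTrek.lats, h1, h2] at this
  have hZ0 : ∀ b, (f b).target ∈ Z → p b 0 = (f b).target := by
    intro b hb
    obtain ⟨h1, h2⟩ := hZ b hb
    have h3 := hmem b 0 (Nat.zero_le _)
    rcases hl : (f b).latent with _ | h
    · exact absurd hl h1
    · simpa only [HalfTrek.rightV, hl, h2, List.toFinset_cons, List.toFinset_nil,
        insert_empty_eq, Finset.mem_singleton] using h3
  set Γ : Matrix T V ℝ[X] := of fun b a => (1 - X) * (1 : Matrix V V ℝ[X]) (f b).source a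
      + X * (1 : Matrix V V ℝ[X]) (p b 0) a with hΓ
  set x : ParamVar DV DLV → ℝ[X] := fun e => match e with
    | Sum.inl e => ((X : ℝ[X]) • pathMatrix ℝ[X] n p) e.1.1 e.1.2
    | Sum.inr (Sum.inl e) => ∑ b, if (f b).latent = some e.1.1 then Γ b e.1.2 else 0
    | Sum.inr (Sum.inr a) => ∑ b, if (f b).latent = none then (1 : Matrix V V ℝ[X]) (f b).source a
        else 0 with hx
  have hlam : lamOf x = (X : ℝ[X]) • pathMatrix ℝ[X] n p := by
    ext1 a b
    simp only [lamOf, of_apply]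
    split_ifs with hab
    · rfl
    · rw [Matrix.smul_apply, pathMatrix, of_apply, if_neg, smul_zero]
      rintro ⟨c, k, hk, rfl, rfl⟩
      exact hab (hr c k hk)
  have hgam : ∀ h a, gamOf x h a = ∑ b, if (f b).latent = some h then Γ b a else 0 := by
    intro h a
    simp only [gamOf, of_apply]
    split_ifs with hha
    · rfl
    · refine (Finset.sum_eq_zero fun b _ => ?_).symm
      split_ifs with hb
      · have h1 : (f b).source ≠ a := by
          rintro rfl
          exact hha ((f b).latent_src h hb)
        have h2 : p b 0 ≠ a := by
          rintro rfl
          exact hha (hlat b h hb)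
        simp [hΓ, h1, h2]
      · rfl
  have hom : diagonal (omOf x) + (gamOf x)ᵀ * gamOf x = Γᵀ * Γ := by
    ext1 i j
    simp only [Matrix.add_apply, Matrix.mul_apply, Matrix.transpose_apply]
    have h1 : diagonal (omOf x) i j
        = ∑ b, if (f b).latent = none then Γ b i * Γ b j else 0 := by
      have h2 : ∀ b, (f b).latent = none → ∀ a,
          Γ b a = (1 : Matrix V V ℝ[X]) (f b).source a := by
        intro b hb a
        simp only [hΓ, of_apply]
        rw [hnone b hb]
        ring
      rw [Matrix.diagonal_apply]
      split_ifs with hij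
      · subst hij
        refine Finset.sum_congr rfl fun b _ => ?_
        split_ifs with hb
        · rw [h2 b hb, Matrix.one_apply]
          split_ifs <;> simp
        · rfl
      · refine (Finset.sum_eq_zero fun b _ => ?_).symm
        split_ifs with hb
        · rw [h2 b hb, h2 b hb, Matrix.one_apply, Matrix.one_apply]
          split_ifs with h3 h4
          · exact absurd (h3.symm.trans h4) hij
          all_goals simp
        · rfl
    have h2 : ∀ h, gamOf x h i * gamOf x h j
        = ∑ b, if (f b).latent = some h then Γ b i * Γ b j else 0 := by
      intro h
      rw [hgam h i, Finset.sum_mul]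
      refine Finset.sum_congr rfl fun b _ => ?_
      split_ifs with hb
      · rw [hgam h j, Finset.sum_eq_single b, if_pos hb]
        · intro b' _ hb'
          rw [if_neg fun h3 => hb' (hlatinj _ _ _ h3 hb)]
        · simp
      · rw [zero_mul]
    rw [h1, Finset.sum_congr rfl fun h _ => h2 h, Finset.sum_comm, ← Finset.sum_add_distrib]
    refine Finset.sum_congr rfl fun b _ => ?_
    rcases hl : (f b).latent with _ | h
    · simp
    · simp
  have hg : ((coefMatrix P Z (MvPolynomial.X (R := ℝ) : ParamVar DV DLV → _)).submatrix
      (fun b => (f b).source) (fun b => (f b).target)).det ≠ 0 := by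
    intro h0
    have h1 := congrArg (MvPolynomial.eval₂Hom (Polynomial.C : ℝ →+* ℝ[X]) x) h0
    rw [RingHom.map_det, map_zero, RingHom.mapMatrix_apply, ← Matrix.submatrix_map,
      map_coefMatrix, show (MvPolynomial.eval₂Hom (Polynomial.C : ℝ →+* ℝ[X]) x) ∘ MvPolynomial.X
        = x from funext fun i => MvPolynomial.eval₂Hom_X' _ _ i, coefMatrix, hom] at h1
    exact det_factorization_ne_zero hp P Z hsrc hn hZ0 hlam hΓ h1
  filter_upwards [eventually_eval_ne_zero hg] with θ h1
  rwa [RingHom.map_det, RingHom.mapMatrix_apply, ← Matrix.submatrix_map, map_coefMatrix,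
    show (MvPolynomial.eval (evalParam DV DLV θ.1 θ.2.1 θ.2.2)) ∘ MvPolynomial.X
      = evalParam DV DLV θ.1 θ.2.1 θ.2.2 from funext fun i => MvPolynomial.eval_X i] at h1

end Coefficients

section LinearSystem

variable {V L : Type*} {DV : Finset (V × V)} {DLV : Finset (L × V)}

theorem exists_isChain_of_reflTransGen {Λ : Matrix V V ℝ} (hΛ : ∀ a b, (a, b) ∉ DV → Λ a b = 0)
    {u y : V} (hr : Relation.ReflTransGen (fun a b => Λ a b ≠ 0) u y) :
    ∃ l, (u :: l).IsChain (fun a b => (a, b) ∈ DV) ∧ (u :: l).getLast (by simp) = y := by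
  refine List.exists_isChain_cons_of_relationReflTransGen (Relation.ReflTransGen.mono (fun a b hab => ?_) _ _ hr)
  by_contra h
  exact hab (hΛ a b h)

variable [DecidableEq V]

theorem mem_paV {w v : V} : w ∈ paV DV v ↔ (w, v) ∈ DV := by
  simp [paV]

variable [Fintype V]

theorem inv_one_sub_apply_eq_zero {Λ : Matrix V V ℝ} (h : IsUnit (1 - Λ)) {u y : V}
    (hn : ¬ Relation.ReflTransGen (fun a b => Λ a b ≠ 0) u y) : (1 - Λ)⁻¹ u y = 0 := by
  set d : V → ℕ := fun i =>
    if Relation.ReflTransGen (fun a b => Λ a b ≠ 0) u i then 1 else 0 with hd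
  have hu : d u = 1 := if_pos Relation.ReflTransGen.refl
  have hy : d y = 0 := if_neg hn
  have hM : BlockTriangular (1 - Λ) d := by
    intro i j hij
    have hi : Relation.ReflTransGen (fun a b => Λ a b ≠ 0) u i := by
      by_contra hi
      simp [hd, hi] at hij
    have hj : ¬ Relation.ReflTransGen (fun a b => Λ a b ≠ 0) u j := by
      intro hj
      simp [hd, hi, hj] at hij
    have hne : i ≠ j := by
      rintro rfl
      exact hj hi
    have h0 : Λ i j = 0 := by
      by_contra h0
      exact hj (hi.tail h0)
    simp [hne, h0]
  let _ := h.invertible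
  exact blockTriangular_inv_of_blockTriangular hM (by rw [hu, hy]; exact one_pos)

/-- The matrix whose row `y` is row `y` of `(I - Λ)ᵀ` if `P y` holds, and of the identity
otherwise. -/
noncomputable def leftTransform (P : V → Prop) (Λ : Matrix V V ℝ) : Matrix V V ℝ :=
  of fun y i => if P y then (1 - Λ) i y else (1 : Matrix V V ℝ) y i

/-- The matrix whose column `w` is column `w` of `I - Λ` if `w ∈ Z`, and of the identity
otherwise. -/
noncomputable def rightTransform (Z : Finset V) (Λ : Matrix V V ℝ) : Matrix V V ℝ :=
  of fun j w => if w ∈ Z then (1 - Λ) j w else (1 : Matrix V V ℝ) j w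

theorem leftTransform_mul_inv (P : V → Prop) {Λ : Matrix V V ℝ} (h : IsUnit (1 - Λ)) (y i : V) :
    (leftTransform P Λ * ((1 - Λ)ᵀ)⁻¹ : Matrix V V ℝ) y i
      = if P y then (1 : Matrix V V ℝ) y i else (1 - Λ)⁻¹ i y := by
  have hu : IsUnit (1 - Λ)ᵀ.det := by
    rw [Matrix.det_transpose]
    exact (Matrix.isUnit_iff_isUnit_det _).mp h
  split_ifs with hy
  · rw [← congrFun₂ (Matrix.mul_nonsing_inv _ hu) y i]
    simp [Matrix.mul_apply, leftTransform, hy, Matrix.one_apply, eq_comm]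
  · rw [← Matrix.transpose_nonsing_inv]
    simp [Matrix.mul_apply, leftTransform, hy, Matrix.one_apply]

theorem inv_mul_rightTransform (Z : Finset V) {Λ : Matrix V V ℝ} (h : IsUnit (1 - Λ)) (j w : V) :
    ((1 - Λ)⁻¹ * rightTransform Z Λ : Matrix V V ℝ) j w
      = if w ∈ Z then (1 : Matrix V V ℝ) j w else (1 - Λ)⁻¹ j w := by
  have hu := (Matrix.isUnit_iff_isUnit_det _).mp h
  split_ifs with hw
  · rw [← congrFun₂ (Matrix.nonsing_inv_mul _ hu) j w]
    simp [Matrix.mul_apply, rightTransform, hw]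
  · simp [Matrix.mul_apply, rightTransform, hw, Matrix.one_apply]

theorem leftFactor_eq (P : V → Prop) {Λ : Matrix V V ℝ} (h : IsUnit (1 - Λ)) :
    leftFactor P Λ = diagonal (fun y => if P y then 1 else (1 - Λ).det)
      * (leftTransform P Λ * ((1 - Λ)ᵀ)⁻¹) := by
  have hu := ((Matrix.isUnit_iff_isUnit_det _).mp h).ne_zero
  ext y i
  rw [Matrix.diagonal_mul, leftTransform_mul_inv P h, leftFactor, of_apply]
  split_ifs
  · simp
  · simp [Matrix.inv_def, hu]

theorem rightFactor_eq (Z : Finset V) {Λ : Matrix V V ℝ} (h : IsUnit (1 - Λ)) :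
    rightFactor Z Λ = ((1 - Λ)⁻¹ * rightTransform Z Λ)
      * diagonal (fun w => if w ∈ Z then 1 else (1 - Λ).det) := by
  have hu := ((Matrix.isUnit_iff_isUnit_det _).mp h).ne_zero
  ext j w
  rw [Matrix.mul_diagonal, inv_mul_rightTransform Z h, rightFactor, of_apply]
  split_ifs
  · simp
  · simp [Matrix.inv_def, mul_comm, hu]

variable {Λ : Matrix V V ℝ} {Γ : Matrix L V ℝ} {ω : V → ℝ}

theorem htrFrom_of_inv_ne_zero (hgood : GoodParams DV DLV Λ Γ ω) (H : Finset L) {j y : V}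
    (hjy : j ≠ y) (h : (1 - Λ)⁻¹ j y ≠ 0) : HtrFrom DV DLV H j y := by
  obtain ⟨l, hl, hlast⟩ := exists_isChain_of_reflTransGen hgood.1
    (not_not.mp fun hn => h (inv_one_sub_apply_eq_zero hgood.2.1 hn))
  refine ⟨hjy, ⟨j, none, l, (List.isChain_cons.mp hl).2, fun _ => (List.isChain_cons.mp hl).1,
    by simp, by simp⟩, rfl, ?_, by simp [HalfTrek.Avoids]⟩
  rw [← hlast, HalfTrek.target, List.getLast_eq_getLastD]

theorem htrFrom_of_latent (hgood : GoodParams DV DLV Λ Γ ω) {H : Finset L} {j u y : V} {h : L}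
    (hjy : j ≠ y) (hh : h ∉ H) (hhj : Γ h j ≠ 0) (hhu : Γ h u ≠ 0) (hn : (1 - Λ)⁻¹ u y ≠ 0) :
    HtrFrom DV DLV H j y := by
  obtain ⟨l, hl, hlast⟩ := exists_isChain_of_reflTransGen hgood.1
    (not_not.mp fun hn' => hn (inv_one_sub_apply_eq_zero hgood.2.1 hn'))
  have hj : (h, j) ∈ DLV := not_not.mp fun h0 => hhj (hgood.2.2.1 _ _ h0)
  have hu : (h, u) ∈ DLV := not_not.mp fun h0 => hhu (hgood.2.2.1 _ _ h0)
  refine ⟨hjy, ⟨j, some h, u :: l, hl, by simp, ?_, ?_⟩, rfl, ?_, ?_⟩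
  · rintro _ ⟨⟩
    exact hj
  · rintro _ ⟨⟩
    exact ⟨u, rfl, hu⟩
  · rw [← hlast, HalfTrek.target, List.getLast_eq_getLastD, List.getLastD_cons]
  · rintro _ ⟨⟩
    exact hh

variable [Fintype L]

/-- On rows `y` outside `U`, the columns of the transformed covariance matrix indexed by `U` only
involve the latent factors in `H`. -/
theorem leftTransform_mul_sigma_apply (hgood : GoodParams DV DLV Λ Γ ω) {H : Finset L}
    {U : Finset V} {y j : V} (hj : j ∈ U) (hy : y ∉ U)
    (hlat : ∀ h, (h, y) ∈ DLV → (h, j) ∈ DLV → h ∈ H) :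
    (leftTransform (HtrReach DV DLV H U) Λ * SigmaMat Λ Γ ω * (1 - Λ)) y j
      = ∑ h ∈ H, (leftTransform (HtrReach DV DLV H U) Λ * ((1 - Λ)ᵀ)⁻¹ * Γᵀ : Matrix V L ℝ) y h * Γ h j := by
  have hu := (Matrix.isUnit_iff_isUnit_det _).mp hgood.2.1
  have hjy : j ≠ y := by
    rintro rfl
    exact hy hj
  set A := leftTransform (HtrReach DV DLV H U) Λ * ((1 - Λ)ᵀ)⁻¹ with hA
  have hAj : A y j = 0 := by
    rw [hA, leftTransform_mul_inv _ hgood.2.1]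
    split_ifs with hP
    · exact Matrix.one_apply_ne hjy.symm
    · by_contra h
      exact hP ⟨j, hj, htrFrom_of_inv_ne_zero hgood H hjy h⟩
  have hAh : ∀ h, h ∉ H → (A * Γᵀ) y h * Γ h j = 0 := by
    intro h hh
    rw [Matrix.mul_apply, Finset.sum_mul]
    refine Finset.sum_eq_zero fun u _ => ?_
    rw [hA, leftTransform_mul_inv _ hgood.2.1, Matrix.transpose_apply]
    by_contra hne
    have hhj : Γ h j ≠ 0 := right_ne_zero_of_mul hne
    have hhu : Γ h u ≠ 0 := right_ne_zero_of_mul (left_ne_zero_of_mul hne)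
    have h0 := left_ne_zero_of_mul (left_ne_zero_of_mul hne)
    split_ifs at h0 with hP
    · obtain rfl : y = u := by
        by_contra hyu
        exact h0 (Matrix.one_apply_ne hyu)
      exact hh (hlat h (not_not.mp fun h0 => hhu (hgood.2.2.1 _ _ h0))
        (not_not.mp fun h0 => hhj (hgood.2.2.1 _ _ h0)))
    · exact hP ⟨j, hj, htrFrom_of_latent hgood hjy hh hhj hhu h0⟩
  have hfac : leftTransform (HtrReach DV DLV H U) Λ * SigmaMat Λ Γ ω * (1 - Λ)
      = A * diagonal ω + A * Γᵀ * Γ := by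
    rw [SigmaMat, hA, Matrix.mul_assoc, Matrix.mul_assoc _ _ (1 - Λ),
      Matrix.nonsing_inv_mul _ hu, Matrix.mul_one, ← Matrix.mul_assoc, Matrix.mul_add,
      ← Matrix.mul_assoc]
  rw [hfac, Matrix.add_apply, Matrix.mul_diagonal, hAj, zero_mul, zero_add, Matrix.mul_apply]
  exact (Finset.sum_subset (Finset.subset_univ H) fun h _ hh => hAh h hh).symm

theorem coefMatrix_evalParam (hgood : GoodParams DV DLV Λ Γ ω) (P : V → Prop) (Z : Finset V) :
    coefMatrix P Z (evalParam DV DLV Λ Γ ω)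
      = diagonal (fun y => if P y then 1 else (1 - Λ).det)
        * (leftTransform P Λ * SigmaMat Λ Γ ω * rightTransform Z Λ)
        * diagonal (fun w => if w ∈ Z then 1 else (1 - Λ).det) := by
  rw [coefMatrix, lamOf_evalParam hgood, gamOf_evalParam hgood, leftFactor_eq P hgood.2.1,
    rightFactor_eq Z hgood.2.1, show omOf (evalParam DV DLV Λ Γ ω) = ω from rfl, SigmaMat]
  simp only [Matrix.mul_assoc]

theorem det_system_ne_zero (hgood : GoodParams DV DLV Λ Γ ω) {T : Type*} [Fintype T]
    [DecidableEq T] (P : V → Prop) (Z : Finset V) (src tgt : T → V)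
    (h : ((coefMatrix P Z (evalParam DV DLV Λ Γ ω)).submatrix src tgt).det ≠ 0) :
    ((leftTransform P Λ * SigmaMat Λ Γ ω * rightTransform Z Λ).submatrix src tgt).det ≠ 0 := by
  intro h0
  apply h
  rw [coefMatrix_evalParam hgood]
  have : ((diagonal (fun y => if P y then 1 else (1 - Λ).det)
      * (leftTransform P Λ * SigmaMat Λ Γ ω * rightTransform Z Λ)
      * diagonal (fun w => if w ∈ Z then 1 else (1 - Λ).det)).submatrix src tgt)
      = diagonal (fun b => if P (src b) then 1 else (1 - Λ).det)
      * (leftTransform P Λ * SigmaMat Λ Γ ω * rightTransform Z Λ).submatrix src tgt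
      * diagonal (fun b => if tgt b ∈ Z then 1 else (1 - Λ).det) := by
    ext1 b b'
    simp only [Matrix.submatrix_apply, Matrix.mul_diagonal, Matrix.diagonal_mul]
  rw [this, Matrix.det_mul, Matrix.det_mul, h0, mul_zero, zero_mul]

/-- The identifying linear system: its solution extends the column `v` of `Λ`. -/
theorem exists_solution (hgood : GoodParams DV DLV Λ Γ ω) {v : V} {Y Z : Finset V}
    {H : Finset L} (hcard : Z.card = H.card) (hZP : Disjoint Z (paV DV v))
    (hYZ : Disjoint Y (insert v Z))
    (hlat : ∀ y ∈ Y, ∀ j ∈ insert v Z, ∀ h, (h, y) ∈ DLV → (h, j) ∈ DLV → h ∈ H)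
    {l : Z → L} (hl : Function.Injective l) (hlH : ∀ z, l z ∈ H)
    (hdet : (Γ.submatrix l (Subtype.val : Z → V)).det ≠ 0)
    {src : ↥(Z ∪ paV DV v) → V} (hsrc : ∀ b, src b ∈ Y) :
    ∃ x : ↥(Z ∪ paV DV v) → ℝ, (∀ b, b.1 ∉ Z → x b = Λ b.1 v) ∧
      ((leftTransform (HtrReach DV DLV H (insert v Z)) Λ * SigmaMat Λ Γ ω
          * rightTransform Z Λ).submatrix src Subtype.val) *ᵥ x
        = fun b => (leftTransform (HtrReach DV DLV H (insert v Z)) Λ * SigmaMat Λ Γ ω)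
          (src b) v := by
  obtain ⟨ψ, hψ⟩ : ∃ ψ : Z → ℝ, Γ.submatrix l (Subtype.val : Z → V) *ᵥ ψ = fun z => Γ (l z) v := by
    refine ⟨(Γ.submatrix l Subtype.val)⁻¹ *ᵥ fun z => Γ (l z) v, ?_⟩
    rw [Matrix.mulVec_mulVec, Matrix.mul_nonsing_inv _ (isUnit_iff_ne_zero.mpr hdet),
      Matrix.one_mulVec]
  have hH : ∀ h ∈ H, Γ h v = ∑ z : Z, Γ h z * ψ z := by
    intro h hh
    have himg : Finset.univ.image l = H := by
      refine Finset.eq_of_subset_of_card_le (fun a ha => ?_) ?_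
      · obtain ⟨z, -, rfl⟩ := Finset.mem_image.mp ha
        exact hlH z
      · rw [Finset.card_image_of_injective _ hl, Finset.card_univ, Fintype.card_coe, hcard]
    rw [← himg] at hh
    obtain ⟨z, -, rfl⟩ := Finset.mem_image.mp hh
    exact (congrFun hψ z).symm
  set K := leftTransform (HtrReach DV DLV H (insert v Z)) Λ * SigmaMat Λ Γ ω with hK
  have hrow : ∀ y ∈ Y, (K * (1 - Λ)) y v = ∑ z : Z, (K * (1 - Λ)) y z * ψ z := by
    intro y hy
    have hyU : y ∉ insert v Z := Finset.disjoint_left.mp hYZ hy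
    rw [leftTransform_mul_sigma_apply hgood (Finset.mem_insert_self v Z) hyU
      (hlat y hy v (Finset.mem_insert_self v Z))]
    rw [Finset.sum_congr rfl fun (z : Z) _ => by
      rw [leftTransform_mul_sigma_apply hgood (Finset.mem_insert_of_mem z.2) hyU
        (hlat y hy z (Finset.mem_insert_of_mem z.2)), Finset.sum_mul], Finset.sum_comm]
    refine Finset.sum_congr rfl fun h hh => ?_
    rw [hH h hh, Finset.mul_sum]
    exact Finset.sum_congr rfl fun z _ => (mul_assoc _ _ _).symm
  set X : V → ℝ := fun b => if h : b ∈ Z then ψ ⟨b, h⟩ else Λ b v with hX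
  refine ⟨fun b => X b, fun b hb => dif_neg hb, funext fun b => ?_⟩
  simp only [mulVec, dotProduct, Matrix.submatrix_apply]
  rw [Finset.sum_coe_sort (Z ∪ paV DV v) (fun w => (K * rightTransform Z Λ) (src b) w * X w),
    Finset.sum_union hZP]
  have hZsum : ∑ w ∈ Z, (K * rightTransform Z Λ) (src b) w * X w = (K * (1 - Λ)) (src b) v := by
    rw [hrow _ (hsrc b), ← Finset.sum_coe_sort Z]
    refine Finset.sum_congr rfl fun z _ => ?_
    congr 1
    · simp [Matrix.mul_apply, rightTransform]
    · simp [hX]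
  have hPsum : ∑ w ∈ paV DV v, (K * rightTransform Z Λ) (src b) w * X w
      = (K * Λ) (src b) v := by
    rw [Matrix.mul_apply, ← Finset.sum_subset (Finset.subset_univ (paV DV v))]
    · refine Finset.sum_congr rfl fun w hw => ?_
      have hwZ : w ∉ Z := Finset.disjoint_right.mp hZP hw
      congr 1
      · simp [Matrix.mul_apply, rightTransform, hwZ, Matrix.one_apply]
      · simp [hX, hwZ]
    · intro w _ hw
      rw [hgood.1 w v (fun h => hw (mem_paV.mpr h)), mul_zero]
  rw [hZsum, hPsum, ← Matrix.add_apply, ← Matrix.mul_add, sub_add_cancel, Matrix.mul_one]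

end LinearSystem

end LFG

open LFG

/-- **LF-HTC identifiability (Theorem 1).**
If `(Y, Z, H)` satisfies the LF-HTC with respect to `v` and all edges of `D_V`
with head in `Z ∪ (Y ∩ htr_H(Z ∪ {v}))` are rationally identifiable, then all
edges of `D_V` with head `v` are rationally identifiable. -/
theorem lfhtc_identifiability
    {V L : Type} [Fintype V] [DecidableEq V] [Fintype L] [DecidableEq L]
    (DV : Finset (V × V)) (DLV : Finset (L × V))
    (hloop : ∀ x : V, (x, x) ∉ DV)
    (v : V) (Y Z : Finset V) (H : Finset L)
    (hcrit : SatisfiesLFHTC DV DLV v Y Z H)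
    (hprev : ∀ u y : V, (u, y) ∈ DV →
      (y ∈ Z ∨ (y ∈ Y ∧ HtrReach DV DLV H (insert v Z) y)) →
      RatIdent DV DLV u y) :
    ∀ u : V, (u, v) ∈ DV → RatIdent DV DLV u v := by
  intro u hu
  obtain ⟨-, -, -, hZH, hZP, hYZ, hlat, f, ⟨htgt, himg, hnsi⟩, hZf⟩ := hcrit
  rw [ratIdent_iff_genRat]
  have hsrcY : ∀ b : ↥(Z ∪ paV DV v), (f b).source ∈ Y := fun b => by
    rw [← himg]
    exact Finset.mem_image_of_mem _ b.2
  have hlat' : ∀ y ∈ Y, ∀ j ∈ insert v Z, ∀ h, (h, y) ∈ DLV → (h, j) ∈ DLV → h ∈ H := by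
    intro y hy j hj h h1 h2
    refine hlat (Finset.mem_inter.mpr ⟨?_, ?_⟩) <;> rw [paL, Finset.mem_image]
    · exact ⟨(h, y), Finset.mem_filter.mpr ⟨h1, hy⟩, rfl⟩
    · exact ⟨(h, j), Finset.mem_filter.mpr ⟨h2, hj⟩, rfl⟩
  choose l hlH hl htail using fun z : Z => hZf z z.2
  have hlinj : Function.Injective l := by
    intro z z' h
    by_contra hz
    have := (hnsi z (Finset.mem_union_left _ z.2) z' (Finset.mem_union_left _ z'.2)
      fun h' => hz (Subtype.ext h')).2.1
    simp [HalfTrek.lats, hl, h] at this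
  have hlz : ∀ z : Z, (l z, z.1) ∈ DLV := by
    intro z
    obtain ⟨x, hx, hxe⟩ := (f z).latent_head (l z) (hl z)
    rw [htail z, List.head?_cons, Option.some.injEq] at hx
    rwa [hx]
  set P := HtrReach DV DLV H (insert v Z) with hP
  have hΛ : ∀ y : V, (y ∈ Z ∨ (y ∈ Y ∧ P y)) → ∀ i,
      GenRat DV DLV (L := L) (fun θ => (1 - θ.1) i y) := by
    intro y hy i
    refine (GenRat.const ((1 : Matrix V V ℝ) i y)).sub ?_
    by_cases h : (i, y) ∈ DV
    · exact ratIdent_iff_genRat.mp (hprev i y h hy)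
    · refine (GenRat.const 0).congr' ?_
      filter_upwards [eventually_good] with θ hθ
      exact (hθ.1 i y h).symm
  have hleft : ∀ y ∈ Y, ∀ i, GenRat DV DLV (L := L)
      (fun θ => (leftTransform P θ.1 * SigmaMat θ.1 θ.2.1 θ.2.2) y i) := by
    intro y hy i
    refine GenRat.matrix_mul y i (fun k => ?_) fun k => GenRat.sigma k i
    simp only [leftTransform, of_apply]
    split_ifs with h
    · exact hΛ y (Or.inr ⟨hy, h⟩) k
    · exact GenRat.const _
  have hright : ∀ j w, GenRat DV DLV (L := L) (fun θ => rightTransform Z θ.1 j w) := by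
    intro j w
    simp only [rightTransform, of_apply]
    split_ifs with h
    · exact hΛ w (Or.inl h) j
    · exact GenRat.const _
  refine GenRat.of_mulVec_eq (n := ↥(Z ∪ paV DV v))
    (M := fun θ => (leftTransform P θ.1 * SigmaMat θ.1 θ.2.1 θ.2.2
      * rightTransform Z θ.1).submatrix (fun b => (f b).source) Subtype.val)
    (c := fun θ b => (leftTransform P θ.1 * SigmaMat θ.1 θ.2.1 θ.2.2) (f b).source v)
    (fun b b' => GenRat.matrix_mul (A := fun θ => leftTransform P θ.1 * SigmaMat θ.1 θ.2.1 θ.2.2)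
      (f b).source b'.1 (hleft _ (hsrcY b)) fun k => hright k _)
    (fun b => hleft _ (hsrcY b) v) ?_
    ⟨u, Finset.mem_union_right _ (mem_paV.mpr hu)⟩ ?_
  · filter_upwards [eventually_good, eventually_det_coefMatrix_ne_zero P Z
      (fun b : ↥(Z ∪ paV DV v) => f b)
      (fun b b' h => hnsi b b.2 b' b'.2 fun h' => h (Subtype.ext h'))
      (fun b hb => by
        rw [htgt b b.2] at hb ⊢
        obtain ⟨h, -, h1, h2⟩ := hZf b hb
        exact ⟨by simp [h1], h2⟩)] with θ hθ hdet
    refine det_system_ne_zero hθ P Z _ _ ?_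
    rwa [show (fun b : ↥(Z ∪ paV DV v) => (f b).target) = Subtype.val from
      funext fun b => htgt b b.2] at hdet
  · filter_upwards [eventually_good,
      eventually_det_gamOf_ne_zero hlinj Subtype.val_injective hlz] with θ hθ hdet
    obtain ⟨x, hx, hMx⟩ := exists_solution hθ hZH hZP hYZ hlat' hlinj hlH hdet hsrcY
    exact ⟨x, hx _ (Finset.disjoint_right.mp hZP (mem_paV.mpr hu)), hMx⟩
end

section
/- Let G = (V ∪ ℒ, D) be a latent-factor graph and fix a node v ∈ V. If the triple (Y, Z, H) satisfies the latent-factor half-trek criterion with respect to v and there is a node h ∈ H with |ch(h)| ≤ 3, then there exist subsets Ỹ ⊆ Y and Z̃ ⊆ Z such that the triple (Ỹ, Z̃, H ∖ {h}) also satisfies the latent-factor half-trek criterion with respect to v. -/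
open scoped Classical
open Matrix

open LFG

/-- **Proposition 11.**
If `(Y, Z, H)` satisfies the LF-HTC with respect to `v` and some `h ∈ H` has at most
three children, then there are subsets `Ỹ ⊆ Y` and `Z̃ ⊆ Z` such that
`(Ỹ, Z̃, H ∖ {h})` also satisfies the LF-HTC with respect to `v`. -/
theorem lfhtc_remove_latent_with_few_children
    {V L : Type} [Fintype V] [DecidableEq V] [Fintype L] [DecidableEq L]
    (DV : Finset (V × V)) (DLV : Finset (L × V))
    (hloop : ∀ x : V, (x, x) ∉ DV)
    (v : V) (Y Z : Finset V) (H : Finset L)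
    (hcrit : SatisfiesLFHTC DV DLV v Y Z H)
    (h : L) (hH : h ∈ H) (hch : (chL DLV {h}).card ≤ 3) :
    ∃ Y' ⊆ Y, ∃ Z' ⊆ Z, SatisfiesLFHTC DV DLV v Y' Z' (H.erase h) := by
  obtain ⟨hvY, hvZ, hYcard, hZcard, hZpa, hYZ, hpaL, f, ⟨htgt, himg, hnsi⟩, hlat⟩ := hcrit
  have : Nonempty L := ⟨h⟩
  choose! g hgH hgf hgt using hlat
  have hg_inj : Set.InjOn g (Z : Set V) := by
    intro a ha b hb hab
    by_contra hne
    have hdis := (hnsi a (Finset.mem_union_left _ ha) b (Finset.mem_union_left _ hb) hne).2.1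
    simp [HalfTrek.lats, hgf a ha, hgf b hb, hab] at hdis
  obtain ⟨z, hz, rfl⟩ : ∃ z ∈ Z, g z = h :=
    (Finset.surj_on_of_inj_on_of_card_le (fun a _ => g a) (fun a ha => hgH a ha)
      (fun a b ha hb hab => hg_inj ha hb hab) hZcard.ge h hH).imp
      fun _ ⟨ha, hab⟩ => ⟨ha, hab.symm⟩
  have hzT : z ∈ Z ∪ paV DV v := Finset.mem_union_left _ hz
  have hzpa : z ∉ paV DV v := Finset.disjoint_left.mp hZpa hz
  have hyY : (f z).source ∈ Y := himg ▸ Finset.mem_image_of_mem (fun b => (f b).source) hzT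
  have hsrc_inj : ∀ b ∈ Z ∪ paV DV v, b ≠ z → (f b).source ≠ (f z).source := by
    intro b hb hbz
    simpa [HalfTrek.leftV] using (hnsi b hb z hzT hbz).1
  have hT : Z.erase z ∪ paV DV v = (Z ∪ paV DV v).erase z := by
    rw [Finset.erase_union_distrib, Finset.erase_eq_of_notMem hzpa]
  have hy_child : (g z, (f z).source) ∈ DLV := (f z).latent_src _ (hgf z hz)
  have hz_child : (g z, z) ∈ DLV := by
    obtain ⟨x, hx, hxD⟩ := (f z).latent_head _ (hgf z hz)
    simp only [hgt z hz, List.head?_cons, Option.some.injEq] at hx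
    exact hx ▸ hxD
  have hdisj : ∀ a ∈ Y, ∀ b ∈ insert v Z, a ≠ b := fun a ha b hb =>
    Finset.disjoint_iff_ne.mp hYZ a ha b hb
  refine ⟨Y.erase (f z).source, Finset.erase_subset _ _, Z.erase z, Finset.erase_subset _ _,
    fun hv => hvY (Finset.mem_of_mem_erase hv), fun hv => hvZ (Finset.mem_of_mem_erase hv),
    ?_, ?_, hZpa.mono_left (Finset.erase_subset _ _), ?_, ?_, f, ⟨?_, ?_, ?_⟩, ?_⟩
  · have hpos := Finset.card_pos.mpr ⟨_, hH⟩
    rw [Finset.card_erase_of_mem hyY, Finset.card_erase_of_mem hH]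
    omega
  · rw [Finset.card_erase_of_mem hz, Finset.card_erase_of_mem hH, hZcard]
  · exact hYZ.mono (Finset.erase_subset _ _)
      (Finset.insert_subset_insert _ (Finset.erase_subset _ _))
  · intro l hl
    obtain ⟨hlY, hlZ⟩ := Finset.mem_inter.mp hl
    simp only [paL, Finset.mem_image, Finset.mem_filter, Prod.exists, exists_and_right,
      exists_eq_right] at hlY hlZ
    obtain ⟨a, haD, ha⟩ := hlY
    obtain ⟨b, hbD, hb⟩ := hlZ
    obtain ⟨hay, haY⟩ := Finset.mem_erase.mp ha
    have hbvZ : b ∈ insert v Z := Finset.insert_subset_insert _ (Finset.erase_subset _ _) hb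
    have hbz : b ≠ z := by
      rintro rfl
      rcases Finset.mem_insert.mp hb with rfl | hb
      · exact hvZ hz
      · exact Finset.notMem_erase _ _ hb
    refine Finset.mem_erase.mpr ⟨?_, hpaL ?_⟩
    · rintro rfl
      have hsub : ({a, b, (f z).source, z} : Finset V) ⊆ chL DLV {g z} := by
        intro c hc
        simp only [Finset.mem_insert, Finset.mem_singleton] at hc
        simp only [chL, Finset.mem_image, Finset.mem_filter, Finset.mem_singleton]
        exact ⟨(g z, c), ⟨by rcases hc with rfl | rfl | rfl | rfl <;> assumption, rfl⟩, rfl⟩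
      have hzvZ : z ∈ insert v Z := Finset.mem_insert_of_mem hz
      have hcard : ({a, b, (f z).source, z} : Finset V).card = 4 := by
        rw [Finset.card_eq_succ]
        refine ⟨a, {b, (f z).source, z}, ?_, rfl, Finset.card_eq_three.mpr
          ⟨b, (f z).source, z, (hdisj _ hyY b hbvZ).symm, hbz, hdisj _ hyY z hzvZ, rfl⟩⟩
        simp [hdisj a haY b hbvZ, hay, hdisj a haY z hzvZ]
      have := Finset.card_le_card hsub
      omega
    · simp only [paL, Finset.mem_inter, Finset.mem_image, Finset.mem_filter]
      exact ⟨⟨(l, a), ⟨haD, haY⟩, rfl⟩, ⟨(l, b), ⟨hbD, hbvZ⟩, rfl⟩⟩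
  · rw [hT]
    exact fun b hb => htgt b (Finset.mem_of_mem_erase hb)
  · rw [hT, ← himg]
    ext y
    simp only [Finset.mem_image, Finset.mem_erase]
    constructor
    · rintro ⟨b, ⟨hbz, hb⟩, rfl⟩
      exact ⟨hsrc_inj b hb hbz, b, hb, rfl⟩
    · rintro ⟨hy, b, hb, rfl⟩
      exact ⟨b, ⟨fun hbz => hy (by rw [hbz]), hb⟩, rfl⟩
  · rw [hT]
    exact fun b₁ h₁ b₂ h₂ =>
      hnsi b₁ (Finset.mem_of_mem_erase h₁) b₂ (Finset.mem_of_mem_erase h₂)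
  · intro b hb
    obtain ⟨hbz, hbZ⟩ := Finset.mem_erase.mp hb
    exact ⟨g b, Finset.mem_erase.mpr ⟨fun hg => hbz (hg_inj hbZ hz hg), hgH b hbZ⟩,
      hgf b hbZ, hgt b hbZ⟩
end

section
/- In the generalized setting with a directed graph G^V = (V, D_V) and a polynomial parametrization τ of the cone of latent covariance matrices, the parameter λ_{ij} (for an edge i → j ∈ D_V) is rationally identifiable if and only if the ideal ℐ = 𝒥 ∩ ℝ[λ, σ] contains a polynomial of the form a(σ)·λ_{ij} − b(σ) with a, b ∈ ℝ[σ] and a ∉ I(φ(Θ)), where I(φ(Θ)) ⊆ ℝ[σ] is the vanishing ideal of the image of the parametrization. -/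
open scoped Classical
open Matrix

namespace GenSEM

variable {V : Type*} [Fintype V] [DecidableEq V]

/-- The type of edges of the directed graph `(V, D_V)`. -/
abbrev Edg (DV : Finset (V × V)) : Type _ := {e : V × V // e ∈ DV}

/-- The matrix `Λ` of variables `λ_{ij}` (for `i → j ∈ D_V`), placed in a polynomial
ring with variable index type `α` via `f`. -/
noncomputable def lamMat (DV : Finset (V × V)) {α : Type*} (f : Edg DV → α) :
    Matrix V V (MvPolynomial α ℝ) :=
  Matrix.of fun i j =>
    if h : (i, j) ∈ DV then MvPolynomial.X (f ⟨(i, j), h⟩) else 0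

/-- The polynomial `d(λ) = det(I - Λ)`. -/
noncomputable def dPoly (DV : Finset (V × V)) {α : Type*} (f : Edg DV → α) :
    MvPolynomial α ℝ :=
  (1 - lamMat DV f).det

/-- The matrix of polynomials `φ̃_{ij}(λ, ω)` with
`φ_{ij}(Λ, Ω) = φ̃_{ij}(λ, ω)/d(λ)²`, obtained via the adjugate:
`φ̃ = adj((I-Λ)ᵀ) Ω adj(I-Λ)`. -/
noncomputable def phiTildeMat (DV : Finset (V × V)) {α : Type*} (f : Edg DV → α)
    (Ω : Matrix V V (MvPolynomial α ℝ)) : Matrix V V (MvPolynomial α ℝ) :=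
  ((1 - lamMat DV f)ᵀ).adjugate * Ω * (1 - lamMat DV f).adjugate

/-- A semialgebraic subset of `ℝ^m`: a finite union of sets described by finitely many
polynomial equations and strict polynomial inequalities. -/
def IsSemialgebraic {m : ℕ} (S : Set (Fin m → ℝ)) : Prop :=
  ∃ (k : ℕ) (P Q : Fin k → Finset (MvPolynomial (Fin m) ℝ)),
    S = ⋃ i, {x | (∀ p ∈ P i, MvPolynomial.eval x p = 0) ∧
                  (∀ q ∈ Q i, 0 < MvPolynomial.eval x q)}

/-- The matrix `τ(Δ)` for a polynomial parametrization `τ`. -/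
noncomputable def tauMat {m : ℕ} (τ : V × V → MvPolynomial (Fin m) ℝ)
    (Δ : Fin m → ℝ) : Matrix V V ℝ :=
  Matrix.of fun i j => MvPolynomial.eval Δ (τ (i, j))

/-- The observed covariance matrix `Σ = (I-Λ)^{-⊤} τ(Δ) (I-Λ)^{-1}`. -/
noncomputable def sigmaGen {m : ℕ} (τ : V × V → MvPolynomial (Fin m) ℝ)
    (Λ : Matrix V V ℝ) (Δ : Fin m → ℝ) : Matrix V V ℝ :=
  ((1 - Λ)ᵀ)⁻¹ * tauMat τ Δ * (1 - Λ)⁻¹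

/-- Evaluation of the entries of `Σ`. -/
noncomputable def sigmaGenEval {m : ℕ} (τ : V × V → MvPolynomial (Fin m) ℝ)
    (Λ : Matrix V V ℝ) (Δ : Fin m → ℝ) : V × V → ℝ :=
  fun uw => sigmaGen τ Λ Δ uw.1 uw.2

/-- Variables `λ, σ` of the subring `ℝ[λ, σ]`. -/
abbrev LSVar (DV : Finset (V × V)) : Type _ := Edg DV ⊕ (V × V)

/-- All variables `λ, σ, δ, ξ` of the ring `ℝ[λ, σ, δ, ξ]`. -/
abbrev BigVar (DV : Finset (V × V)) (m : ℕ) : Type _ := LSVar DV ⊕ (Fin m ⊕ Unit)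

/-- The ideal `𝒥 = ⟨{σ_{ij} d(λ)² − φ̃_{ij}(λ, τ(δ))} ∪ {ξ d(λ) − 1}⟩ ⊆ ℝ[λ, σ, δ, ξ]`. -/
noncomputable def Jideal (DV : Finset (V × V)) {m : ℕ}
    (τ : V × V → MvPolynomial (Fin m) ℝ) :
    Ideal (MvPolynomial (BigVar DV m) ℝ) :=
  Ideal.span
    ((Set.range fun ij : V × V =>
        MvPolynomial.X (Sum.inl (Sum.inr ij))
            * dPoly DV (Sum.inl ∘ Sum.inl : Edg DV → BigVar DV m) ^ 2
          - phiTildeMat DV (Sum.inl ∘ Sum.inl : Edg DV → BigVar DV m)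
              (Matrix.of fun i j =>
                MvPolynomial.rename (Sum.inr ∘ Sum.inl : Fin m → BigVar DV m) (τ (i, j)))
              ij.1 ij.2)
      ∪ {MvPolynomial.X (Sum.inr (Sum.inr ()))
           * dPoly DV (Sum.inl ∘ Sum.inl : Edg DV → BigVar DV m) - 1})

/-- The parameter `λ_{ij}` is rationally identifiable in the generalized setting: there
are `a, b ∈ ℝ[σ]` and a nonzero polynomial `g` in the free entries of `(Λ, Δ)` such
that `λ_{ij} = b(Σ)/a(Σ)` whenever `g(Λ, Δ) ≠ 0`. -/
def RatIdentGen (DV : Finset (V × V)) {m : ℕ} (S : Set (Fin m → ℝ))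
    (τ : V × V → MvPolynomial (Fin m) ℝ) (i j : V) : Prop :=
  ∃ (b a : MvPolynomial (V × V) ℝ) (g : MvPolynomial (Edg DV ⊕ Fin m) ℝ),
    g ≠ 0 ∧
    ∀ (Λ : Matrix V V ℝ) (Δ : Fin m → ℝ),
      (∀ u w : V, (u, w) ∉ DV → Λ u w = 0) → IsUnit (1 - Λ) → Δ ∈ S →
      MvPolynomial.eval (Sum.elim (fun e : Edg DV => Λ e.1.1 e.1.2) Δ) g ≠ 0 →
      MvPolynomial.eval (sigmaGenEval τ Λ Δ) a ≠ 0 ∧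
      Λ i j * MvPolynomial.eval (sigmaGenEval τ Λ Δ) a
        = MvPolynomial.eval (sigmaGenEval τ Λ Δ) b

end GenSEM

open GenSEM

namespace GenSEM

/-- A real polynomial vanishing on a nonempty open set is zero. -/
theorem eq_zero_of_eval_eq_zero_of_isOpen {ι : Type*} [Finite ι] {U : Set (ι → ℝ)}
    (hU : IsOpen U) (hne : U.Nonempty) {p : MvPolynomial ι ℝ}
    (hp : ∀ x ∈ U, MvPolynomial.eval x p = 0) : p = 0 := by
  have := Fintype.ofFinite ι
  obtain ⟨x, hx⟩ := hne
  obtain ⟨ε, hε, hball⟩ := Metric.isOpen_iff.1 hU x hx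
  refine MvPolynomial.funext_set (fun i => Metric.ball (x i) ε) (fun i => ?_) fun y hy => ?_
  · rw [Real.ball_eq_Ioo]
    exact Set.Ioo_infinite (by linarith)
  · rw [map_zero]
    exact hp y (hball ((ball_pi x hε).symm ▸ hy))

theorem map_lamMat {V : Type*} [DecidableEq V] {DV : Finset (V × V)} {α : Type*} (f : Edg DV → α) (y : α → ℝ)
    {Λ : Matrix V V ℝ} (hΛ : ∀ u w : V, (u, w) ∉ DV → Λ u w = 0)
    (hy : ∀ e : Edg DV, y (f e) = Λ e.1.1 e.1.2) :
    (1 - lamMat DV f).map (MvPolynomial.eval y) = 1 - Λ := by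
  have h : (lamMat DV f).map (MvPolynomial.eval y) = Λ := by
    ext u w
    by_cases huw : (u, w) ∈ DV
    · simp [lamMat, huw, hy]
    · simp [lamMat, huw, hΛ u w huw]
  rw [Matrix.map_sub _ (map_sub _), h, Matrix.map_one _ (map_zero _) (map_one _)]

variable {V : Type*} [Fintype V] [DecidableEq V]

theorem eval_dPoly {DV : Finset (V × V)} {α : Type*} (f : Edg DV → α) (y : α → ℝ)
    {Λ : Matrix V V ℝ} (hΛ : ∀ u w : V, (u, w) ∉ DV → Λ u w = 0)
    (hy : ∀ e : Edg DV, y (f e) = Λ e.1.1 e.1.2) :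
    MvPolynomial.eval y (dPoly DV f) = (1 - Λ).det := by
  rw [← map_lamMat f y hΛ hy, dPoly, RingHom.map_det, RingHom.mapMatrix_apply]

theorem map_phiTildeMat {DV : Finset (V × V)} {α : Type*} (f : Edg DV → α) (y : α → ℝ)
    {Λ : Matrix V V ℝ} (hΛ : ∀ u w : V, (u, w) ∉ DV → Λ u w = 0)
    (hy : ∀ e : Edg DV, y (f e) = Λ e.1.1 e.1.2) (Ω : Matrix V V (MvPolynomial α ℝ)) :
    (phiTildeMat DV f Ω).map (MvPolynomial.eval y) =
      ((1 - Λ)ᵀ).adjugate * Ω.map (MvPolynomial.eval y) * (1 - Λ).adjugate := by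
  rw [← map_lamMat f y hΛ hy, phiTildeMat, Matrix.map_mul, Matrix.map_mul, ← Matrix.transpose_map]
  simp only [← RingHom.mapMatrix_apply, RingHom.map_adjugate]

theorem rename_dPoly {DV : Finset (V × V)} {α β : Type*} (f : Edg DV → α) (k : α → β) :
    MvPolynomial.rename k (dPoly DV f) = dPoly DV (k ∘ f) := by
  rw [dPoly, dPoly, AlgHom.map_det, AlgHom.mapMatrix_apply, Matrix.map_sub _ (map_sub _),
    Matrix.map_one _ (map_zero _) (map_one _)]
  congr 2
  ext u w : 2
  by_cases huw : (u, w) ∈ DV <;> simp [lamMat, huw]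

theorem rename_phiTildeMat {DV : Finset (V × V)} {α β : Type*} (f : Edg DV → α) (k : α → β)
    (Ω : Matrix V V (MvPolynomial α ℝ)) :
    (phiTildeMat DV f Ω).map (MvPolynomial.rename k) =
      phiTildeMat DV (k ∘ f) (Ω.map (MvPolynomial.rename k)) := by
  have h : (1 - lamMat DV f).map (MvPolynomial.rename k) = 1 - lamMat DV (k ∘ f) := by
    rw [Matrix.map_sub _ (map_sub _), Matrix.map_one _ (map_zero _) (map_one _)]
    congr 1
    ext u w : 2
    by_cases huw : (u, w) ∈ DV <;> simp [lamMat, huw]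
  rw [phiTildeMat, phiTildeMat, Matrix.map_mul, Matrix.map_mul, ← h, ← Matrix.transpose_map]
  simp only [← AlgHom.mapMatrix_apply, AlgHom.map_adjugate]

/-- The free entries of `(Λ, Δ)`. -/
def paramPoint (DV : Finset (V × V)) {m : ℕ} (Λ : Matrix V V ℝ) (Δ : Fin m → ℝ) :
    Edg DV ⊕ Fin m → ℝ :=
  Sum.elim (fun e : Edg DV => Λ e.1.1 e.1.2) Δ

/-- The point `(Λ, φ(Λ, τ(Δ)), Δ, 1 / d(Λ))` of the zero set of `𝒥`. -/
noncomputable def bigPoint (DV : Finset (V × V)) {m : ℕ} (τ : V × V → MvPolynomial (Fin m) ℝ)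
    (Λ : Matrix V V ℝ) (Δ : Fin m → ℝ) : BigVar DV m → ℝ :=
  Sum.elim (Sum.elim (fun e : Edg DV => Λ e.1.1 e.1.2) (sigmaGenEval τ Λ Δ))
    (Sum.elim Δ fun _ => (1 - Λ).det⁻¹)

/-- The inclusion of the variables `λ, δ` into `λ, σ, δ, ξ`. -/
def paramVar (DV : Finset (V × V)) (m : ℕ) : Edg DV ⊕ Fin m → BigVar DV m :=
  Sum.elim (Sum.inl ∘ Sum.inl) (Sum.inr ∘ Sum.inl)

theorem bigPoint_comp_paramVar (DV : Finset (V × V)) {m : ℕ}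
    (τ : V × V → MvPolynomial (Fin m) ℝ) (Λ : Matrix V V ℝ) (Δ : Fin m → ℝ) :
    bigPoint DV τ Λ Δ ∘ paramVar DV m = paramPoint DV Λ Δ := by
  ext (e | k) <;> rfl

theorem sigmaGen_mul_det_sq {m : ℕ} (τ : V × V → MvPolynomial (Fin m) ℝ)
    {Λ : Matrix V V ℝ} (hdet : (1 - Λ).det ≠ 0) (Δ : Fin m → ℝ) (u w : V) :
    sigmaGen τ Λ Δ u w * (1 - Λ).det ^ 2 =
      (((1 - Λ)ᵀ).adjugate * tauMat τ Δ * (1 - Λ).adjugate : Matrix V V ℝ) u w := by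
  rw [sigmaGen, Matrix.inv_def, Matrix.inv_def, Matrix.det_transpose, Ring.inverse_eq_inv']
  simp only [Matrix.smul_mul, Matrix.mul_smul, Matrix.smul_apply, smul_eq_mul]
  field_simp

theorem eval_bigPoint_eq_zero_of_mem_Jideal {DV : Finset (V × V)} {m : ℕ}
    {τ : V × V → MvPolynomial (Fin m) ℝ} {Λ : Matrix V V ℝ} (Δ : Fin m → ℝ)
    (hΛ : ∀ u w : V, (u, w) ∉ DV → Λ u w = 0) (hdet : (1 - Λ).det ≠ 0)
    {p : MvPolynomial (BigVar DV m) ℝ} (hp : p ∈ Jideal DV τ) :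
    MvPolynomial.eval (bigPoint DV τ Λ Δ) p = 0 := by
  suffices h : Jideal DV τ ≤ RingHom.ker (MvPolynomial.eval (bigPoint DV τ Λ Δ)) from h hp
  have hd := eval_dPoly (Sum.inl ∘ Sum.inl : Edg DV → BigVar DV m) (bigPoint DV τ Λ Δ) hΛ
    fun _ => rfl
  refine Ideal.span_le.2 ?_
  rintro _ (⟨⟨u, w⟩, rfl⟩ | rfl)
  · have hφ := congrFun₂ (map_phiTildeMat (Sum.inl ∘ Sum.inl : Edg DV → BigVar DV m)
      (bigPoint DV τ Λ Δ) hΛ (fun _ => rfl) (Matrix.of fun i j =>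
        MvPolynomial.rename (Sum.inr ∘ Sum.inl : Fin m → BigVar DV m) (τ (i, j)))) u w
    have hτ : (Matrix.of fun i j =>
        MvPolynomial.rename (Sum.inr ∘ Sum.inl : Fin m → BigVar DV m) (τ (i, j))).map
          (MvPolynomial.eval (bigPoint DV τ Λ Δ)) = tauMat τ Δ := by
      ext u w
      simp only [Matrix.map_apply, Matrix.of_apply, MvPolynomial.eval_rename, tauMat]
      rfl
    rw [hτ, ← sigmaGen_mul_det_sq τ hdet, Matrix.map_apply] at hφ
    simp only [SetLike.mem_coe, RingHom.mem_ker, map_sub, map_mul, map_pow, hd, hφ,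
      MvPolynomial.eval_X]
    exact sub_self _
  · simp only [SetLike.mem_coe, RingHom.mem_ker, map_sub, map_mul, hd, MvPolynomial.eval_X,
      map_one]
    exact sub_eq_zero.2 (inv_mul_cancel₀ hdet)

/-- Modulo `𝒥`, every polynomial becomes a polynomial in `λ, δ` after multiplication by a
power of `d(λ)`. -/
theorem exists_dPoly_pow_mul_sub_rename_mem_Jideal {DV : Finset (V × V)} {m : ℕ}
    (τ : V × V → MvPolynomial (Fin m) ℝ) (p : MvPolynomial (BigVar DV m) ℝ) :
    ∃ (N : ℕ) (G : MvPolynomial (Edg DV ⊕ Fin m) ℝ),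
      dPoly DV (Sum.inl ∘ Sum.inl : Edg DV → BigVar DV m) ^ N * p
        - MvPolynomial.rename (paramVar DV m) G ∈ Jideal DV τ := by
  have hd : MvPolynomial.rename (paramVar DV m) (dPoly DV Sum.inl) =
      dPoly DV (Sum.inl ∘ Sum.inl : Edg DV → BigVar DV m) := rename_dPoly _ _
  have hmul : ∀ p q : MvPolynomial (BigVar DV m) ℝ,
      (∃ (N : ℕ) (G : MvPolynomial (Edg DV ⊕ Fin m) ℝ),
        dPoly DV (Sum.inl ∘ Sum.inl : Edg DV → BigVar DV m) ^ N * p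
          - MvPolynomial.rename (paramVar DV m) G ∈ Jideal DV τ) →
      (∃ (N : ℕ) (G : MvPolynomial (Edg DV ⊕ Fin m) ℝ),
        dPoly DV (Sum.inl ∘ Sum.inl : Edg DV → BigVar DV m) ^ N * q
          - MvPolynomial.rename (paramVar DV m) G ∈ Jideal DV τ) →
      ∃ (N : ℕ) (G : MvPolynomial (Edg DV ⊕ Fin m) ℝ),
        dPoly DV (Sum.inl ∘ Sum.inl : Edg DV → BigVar DV m) ^ N * (p * q)
          - MvPolynomial.rename (paramVar DV m) G ∈ Jideal DV τ := by
    rintro p q ⟨M, G, hG⟩ ⟨N, H, hH⟩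
    refine ⟨M + N, G * H, ?_⟩
    rw [map_mul]
    convert (Jideal DV τ).add_mem
      ((Jideal DV τ).mul_mem_left
        (dPoly DV (Sum.inl ∘ Sum.inl : Edg DV → BigVar DV m) ^ N * q) hG)
      ((Jideal DV τ).mul_mem_left (MvPolynomial.rename (paramVar DV m) G) hH) using 1
    ring
  induction p using MvPolynomial.induction_on with
  | C r => exact ⟨0, MvPolynomial.C r, by simp⟩
  | add p q hp hq =>
    obtain ⟨M, G, hG⟩ := hp
    obtain ⟨N, H, hH⟩ := hq
    refine ⟨M + N, dPoly DV Sum.inl ^ N * G + dPoly DV Sum.inl ^ M * H, ?_⟩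
    rw [map_add, map_mul, map_mul, map_pow, map_pow, hd]
    convert (Jideal DV τ).add_mem
      ((Jideal DV τ).mul_mem_left
        (dPoly DV (Sum.inl ∘ Sum.inl : Edg DV → BigVar DV m) ^ N) hG)
      ((Jideal DV τ).mul_mem_left
        (dPoly DV (Sum.inl ∘ Sum.inl : Edg DV → BigVar DV m) ^ M) hH) using 1
    ring
  | mul_X p v hp =>
    refine hmul p _ hp ?_
    rcases v with (e | uw) | (k | ⟨⟩)
    · exact ⟨0, MvPolynomial.X (Sum.inl e), by simp [paramVar]⟩
    · refine ⟨2, phiTildeMat DV Sum.inl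
        (Matrix.of fun i j => MvPolynomial.rename Sum.inr (τ (i, j))) uw.1 uw.2, ?_⟩
      have h := congrFun₂ (rename_phiTildeMat (Sum.inl : Edg DV → Edg DV ⊕ Fin m) (paramVar DV m)
        (Matrix.of fun i j => MvPolynomial.rename Sum.inr (τ (i, j)))) uw.1 uw.2
      have hΩ : (Matrix.of fun i j => MvPolynomial.rename
          (Sum.inr : Fin m → Edg DV ⊕ Fin m) (τ (i, j))).map
            (MvPolynomial.rename (R := ℝ) (paramVar DV m)) =
          Matrix.of fun i j =>
            MvPolynomial.rename (Sum.inr ∘ Sum.inl : Fin m → BigVar DV m) (τ (i, j)) := by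
        ext u w : 2
        rw [Matrix.map_apply, Matrix.of_apply, Matrix.of_apply, MvPolynomial.rename_rename]
        rfl
      have hc : paramVar DV m ∘ Sum.inl = Sum.inl ∘ Sum.inl := rfl
      rw [Matrix.map_apply, hΩ, hc] at h
      rw [h, mul_comm]
      exact Ideal.subset_span (Or.inl ⟨uw, rfl⟩)
    · exact ⟨0, MvPolynomial.X (Sum.inr k), by simp [paramVar]⟩
    · refine ⟨1, 1, ?_⟩
      rw [pow_one, map_one, mul_comm]
      exact Ideal.subset_span (Or.inr rfl)

theorem mem_Jideal_of_dPoly_pow_mul_mem {DV : Finset (V × V)} {m : ℕ}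
    {τ : V × V → MvPolynomial (Fin m) ℝ} {p : MvPolynomial (BigVar DV m) ℝ} {N : ℕ}
    (h : dPoly DV (Sum.inl ∘ Sum.inl : Edg DV → BigVar DV m) ^ N * p ∈ Jideal DV τ) :
    p ∈ Jideal DV τ := by
  have hξ : MvPolynomial.X (Sum.inr (Sum.inr ()))
      * dPoly DV (Sum.inl ∘ Sum.inl : Edg DV → BigVar DV m) - 1 ∈ Jideal DV τ :=
    Ideal.subset_span (Or.inr rfl)
  have hpow := Ideal.mem_of_dvd _ (sub_dvd_pow_sub_pow _ _ N) hξ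
  convert (Jideal DV τ).sub_mem
    ((Jideal DV τ).mul_mem_left (MvPolynomial.X (Sum.inr (Sum.inr ())) ^ N) h)
    ((Jideal DV τ).mul_mem_left p hpow) using 1
  ring

/-- A polynomial in `λ, δ` vanishing at all parameters with `d(Λ) ≠ 0` is zero. -/
theorem eq_zero_of_eval_paramPoint_eq_zero {DV : Finset (V × V)} {m : ℕ} {S : Set (Fin m → ℝ)}
    (hSne : S.Nonempty) (hSopen : IsOpen S) {G : MvPolynomial (Edg DV ⊕ Fin m) ℝ}
    (hG : ∀ (Λ : Matrix V V ℝ) (Δ : Fin m → ℝ), (∀ u w : V, (u, w) ∉ DV → Λ u w = 0) →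
      (1 - Λ).det ≠ 0 → Δ ∈ S → MvPolynomial.eval (paramPoint DV Λ Δ) G = 0) : G = 0 := by
  have hd : dPoly DV (Sum.inl : Edg DV → Edg DV ⊕ Fin m) ≠ 0 := by
    intro h
    have h1 := eval_dPoly (Sum.inl : Edg DV → Edg DV ⊕ Fin m) (0 : Edg DV ⊕ Fin m → ℝ)
      (Λ := 0) (fun _ _ _ => rfl) fun _ => rfl
    simp [h] at h1
  refine (mul_eq_zero.1 ?_).resolve_left hd
  obtain ⟨Δ₀, hΔ₀⟩ := hSne
  refine eq_zero_of_eval_eq_zero_of_isOpen (U := (fun x => x ∘ Sum.inr) ⁻¹' S)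
    (hSopen.preimage (by fun_prop)) ⟨Sum.elim 0 Δ₀, hΔ₀⟩ fun x hx => ?_
  set Λ : Matrix V V ℝ :=
    Matrix.of fun u w => if h : (u, w) ∈ DV then x (Sum.inl ⟨(u, w), h⟩) else 0 with hΛdef
  have hΛ : ∀ u w : V, (u, w) ∉ DV → Λ u w = 0 := fun u w h => by simp [hΛdef, h]
  have hΛx : ∀ e : Edg DV, x (Sum.inl e) = Λ e.1.1 e.1.2 := fun e => by simp [hΛdef]
  have hxp : paramPoint DV Λ (x ∘ Sum.inr) = x := by
    ext (e | k)
    · exact (hΛx e).symm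
    · rfl
  rw [map_mul, eval_dPoly _ x hΛ hΛx]
  by_cases hdet : (1 - Λ).det = 0
  · rw [hdet, zero_mul]
  · have := hG Λ (x ∘ Sum.inr) hΛ hdet hx
    rw [hxp] at this
    rw [this, mul_zero]

theorem det_pow_mul_eval_bigPoint {DV : Finset (V × V)} {m : ℕ}
    {τ : V × V → MvPolynomial (Fin m) ℝ} {Λ : Matrix V V ℝ} (Δ : Fin m → ℝ)
    (hΛ : ∀ u w : V, (u, w) ∉ DV → Λ u w = 0) (hdet : (1 - Λ).det ≠ 0)
    {p : MvPolynomial (BigVar DV m) ℝ} {N : ℕ} {G : MvPolynomial (Edg DV ⊕ Fin m) ℝ}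
    (h : dPoly DV (Sum.inl ∘ Sum.inl : Edg DV → BigVar DV m) ^ N * p
        - MvPolynomial.rename (paramVar DV m) G ∈ Jideal DV τ) :
    (1 - Λ).det ^ N * MvPolynomial.eval (bigPoint DV τ Λ Δ) p =
      MvPolynomial.eval (paramPoint DV Λ Δ) G := by
  have h0 := eval_bigPoint_eq_zero_of_mem_Jideal Δ hΛ hdet h
  rwa [map_sub, map_mul, map_pow, eval_dPoly _ (bigPoint DV τ Λ Δ) hΛ fun _ => rfl,
    MvPolynomial.eval_rename, bigPoint_comp_paramVar, sub_eq_zero] at h0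

end GenSEM

/-- **Proposition 13: algebraic characterization of rational identifiability.**
In the generalized setting, `λ_{ij}` is rationally identifiable if and only if the
ideal `ℐ = 𝒥 ∩ ℝ[λ, σ]` contains a polynomial `a(σ) λ_{ij} − b(σ)` with
`a ∉ I(φ(Θ))`, the vanishing ideal of the image of the parametrization. -/
theorem rat_ident_iff_ideal_membership
    {V : Type} [Fintype V] [DecidableEq V]
    (DV : Finset (V × V)) (hloop : ∀ x : V, (x, x) ∉ DV)
    (m : ℕ) (S : Set (Fin m → ℝ))
    (hSne : S.Nonempty) (hSopen : IsOpen S) (hSsemi : IsSemialgebraic S)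
    (τ : V × V → MvPolynomial (Fin m) ℝ)
    (hτsym : ∀ i j : V, τ (i, j) = τ (j, i))
    (hτpd : ∀ Δ ∈ S, (tauMat τ Δ).PosDef)
    (i j : V) (hij : (i, j) ∈ DV) :
    RatIdentGen DV S τ i j ↔
      ∃ a b : MvPolynomial (V × V) ℝ,
        -- a ∉ I(φ(Θ))
        (¬ ∀ (Λ : Matrix V V ℝ) (Δ : Fin m → ℝ),
            (∀ u w : V, (u, w) ∉ DV → Λ u w = 0) → IsUnit (1 - Λ) → Δ ∈ S →
            MvPolynomial.eval (sigmaGenEval τ Λ Δ) a = 0) ∧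
        -- a(σ) λ_{ij} − b(σ) ∈ ℐ = 𝒥 ∩ ℝ[λ, σ]
        MvPolynomial.rename (Sum.inl : LSVar DV → BigVar DV m)
          (MvPolynomial.rename (Sum.inr : V × V → LSVar DV) a
              * MvPolynomial.X (Sum.inl ⟨(i, j), hij⟩)
            - MvPolynomial.rename (Sum.inr : V × V → LSVar DV) b) ∈ Jideal DV τ := by
  have hunit : ∀ Λ : Matrix V V ℝ, IsUnit (1 - Λ) ↔ (1 - Λ).det ≠ 0 := fun Λ => by
    rw [Matrix.isUnit_iff_isUnit_det, isUnit_iff_ne_zero]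
  have heval : ∀ (a b : MvPolynomial (V × V) ℝ) (Λ : Matrix V V ℝ) (Δ : Fin m → ℝ),
      MvPolynomial.eval (bigPoint DV τ Λ Δ)
        (MvPolynomial.rename (Sum.inl : LSVar DV → BigVar DV m)
          (MvPolynomial.rename (Sum.inr : V × V → LSVar DV) a
              * MvPolynomial.X (Sum.inl ⟨(i, j), hij⟩)
            - MvPolynomial.rename (Sum.inr : V × V → LSVar DV) b)) =
        MvPolynomial.eval (sigmaGenEval τ Λ Δ) a * Λ i j
          - MvPolynomial.eval (sigmaGenEval τ Λ Δ) b := fun a b Λ Δ => by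
    simp only [map_sub, map_mul, MvPolynomial.rename_rename, MvPolynomial.eval_rename,
      MvPolynomial.rename_X, MvPolynomial.eval_X]
    rfl
  constructor
  · rintro ⟨b, a, g, hg, h⟩
    refine ⟨a, b, fun ha => hg ?_, ?_⟩
    · refine eq_zero_of_eval_paramPoint_eq_zero hSne hSopen fun Λ Δ hΛ hdet hΔ => ?_
      by_contra hne
      exact (h Λ Δ hΛ ((hunit Λ).2 hdet) hΔ hne).1 (ha Λ Δ hΛ ((hunit Λ).2 hdet) hΔ)
    · obtain ⟨N, G, hG⟩ := exists_dPoly_pow_mul_sub_rename_mem_Jideal τ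
        (MvPolynomial.rename (Sum.inl : LSVar DV → BigVar DV m)
          (MvPolynomial.rename (Sum.inr : V × V → LSVar DV) a
              * MvPolynomial.X (Sum.inl ⟨(i, j), hij⟩)
            - MvPolynomial.rename (Sum.inr : V × V → LSVar DV) b))
      have hG0 : G = 0 := by
        refine (mul_eq_zero.1 ?_).resolve_left hg
        refine eq_zero_of_eval_paramPoint_eq_zero hSne hSopen fun Λ Δ hΛ hdet hΔ => ?_
        rw [map_mul]
        by_cases hgz : MvPolynomial.eval (paramPoint DV Λ Δ) g = 0
        · rw [hgz, zero_mul]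
        · rw [← det_pow_mul_eval_bigPoint Δ hΛ hdet hG, heval, mul_comm _ (Λ i j),
            (h Λ Δ hΛ ((hunit Λ).2 hdet) hΔ hgz).2, sub_self, mul_zero, mul_zero]
      rw [hG0, map_zero, sub_zero] at hG
      exact mem_Jideal_of_dPoly_pow_mul_mem hG
  · rintro ⟨a, b, ha, hmem⟩
    have hevala : ∀ (Λ : Matrix V V ℝ) (Δ : Fin m → ℝ),
        MvPolynomial.eval (bigPoint DV τ Λ Δ)
          (MvPolynomial.rename (Sum.inl ∘ Sum.inr : V × V → BigVar DV m) a) =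
          MvPolynomial.eval (sigmaGenEval τ Λ Δ) a := fun Λ Δ => by
      rw [MvPolynomial.eval_rename]
      rfl
    obtain ⟨N, G, hG⟩ := exists_dPoly_pow_mul_sub_rename_mem_Jideal τ
      (MvPolynomial.rename (Sum.inl ∘ Sum.inr : V × V → BigVar DV m) a)
    refine ⟨b, a, G, fun hG0 => ha fun Λ Δ hΛ hu _ => ?_, fun Λ Δ hΛ hu _ hne => ⟨?_, ?_⟩⟩
    · have hdet := (hunit Λ).1 hu
      have h := det_pow_mul_eval_bigPoint Δ hΛ hdet hG
      rw [hevala, hG0, map_zero] at h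
      exact (mul_eq_zero.1 h).resolve_left (pow_ne_zero N hdet)
    · intro ha0
      refine hne ((det_pow_mul_eval_bigPoint Δ hΛ ((hunit Λ).1 hu) hG).symm.trans ?_)
      rw [hevala, ha0, mul_zero]
    · have h := eval_bigPoint_eq_zero_of_mem_Jideal Δ hΛ ((hunit Λ).1 hu) hmem
      rw [heval, sub_eq_zero] at h
      rw [mul_comm, h]
end
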